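/- arXiv:1111.3480 — 3 statements merged into one kernel-verified Lean document; each statement's English description precedes it below -/
import Mathlib

section
/- Let G be a finite connected bridgeless graph, let r ≥ 1 be an integer such that some vertex u of G satisfies d_G(u,v) ≤ r for every vertex v (i.e., rad(G) ≤ r), and let η ≥ 3 be an integer such that every edge of G is contained in a cycle of length at most η. Then G admits an orientation H of radius at most Σ_{i=1}^{r} min{2i, η−1}; in particular, G admits an orientation of radius at most r(η−1). -/
open SimpleGraph Finset

variable {V : Type*}

/-- `o` is an orientation of `G`: each edge of `G` gets exactly one direction. -/
def IsOrientation (G : SimpleGraph V) (o : V → V → Prop) : Prop :=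
  (∀ x y, o x y → G.Adj x y) ∧ (∀ x y, G.Adj x y → (o x y ∨ o y x)) ∧
    (∀ x y, o x y → ¬ o y x)

/-- There is a directed path (with respect to `o`) from `x` to `y` of length at most `n`. -/
def DPathLE (o : V → V → Prop) (n : ℕ) (x y : V) : Prop :=
  ∃ m ≤ n, ∃ f : ℕ → V, f 0 = x ∧ f m = y ∧ (∀ i < m, o (f i) (f (i + 1))) ∧
    (∀ i ≤ m, ∀ j ≤ m, f i = f j → i = j)

/-- `G` admits an orientation of radius at most `R`. -/
def OrientRadiusLE (G : SimpleGraph V) (R : ℕ) : Prop :=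
  ∃ o : V → V → Prop, IsOrientation G o ∧
    ∃ u : V, ∀ v : V, DPathLE o R u v ∧ DPathLE o R v u

/-- `G` admits an orientation of diameter at most `D`. -/
def OrientDiamLE (G : SimpleGraph V) (D : ℕ) : Prop :=
  ∃ o : V → V → Prop, IsOrientation G o ∧ ∀ x y : V, DPathLE o D x y

/-- The edge `e` lies on a cycle of `G` of length at most `n`. -/
def InCycleLE (G : SimpleGraph V) (e : Sym2 V) (n : ℕ) : Prop :=
  ∃ (v : V) (c : G.Walk v v), c.IsCycle ∧ e ∈ c.edges ∧ c.length ≤ n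

/-- `G` is bridgeless: no edge is a cut edge. -/
def Bridgeless (G : SimpleGraph V) : Prop :=
  ∀ e ∈ G.edgeSet, ¬ G.IsBridge e

/-- `c` is a rainbow `k`-edge-coloring of `G`: every two distinct vertices are joined
by a path whose edges receive pairwise distinct colors. -/
def IsRainbowColoring (G : SimpleGraph V) (k : ℕ) (c : Sym2 V → Fin k) : Prop :=
  ∀ x y : V, x ≠ y → ∃ p : G.Walk x y, p.IsPath ∧ (p.edges.map c).Nodup

/-- The rainbow connection number of `G` is at most `k`. -/
def RcLE (G : SimpleGraph V) (k : ℕ) : Prop :=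
  ∃ c : Sym2 V → Fin k, IsRainbowColoring G k c


/-- Walk of length exactly `n` along the relation `o`. -/
def WW (o : V → V → Prop) : ℕ → V → V → Prop
  | 0, x, y => x = y
  | n + 1, x, y => ∃ z, WW o n x z ∧ o z y

/-- Walk of length at most `n`. -/
def WL (o : V → V → Prop) (n : ℕ) (x y : V) : Prop := ∃ m ≤ n, WW o m x y

theorem WW.add {o : V → V → Prop} {a b : ℕ} {x y z : V} (h1 : WW o a x y) (h2 : WW o b y z) :
    WW o (a + b) x z := by
  induction b generalizing z with
  | zero => cases h2; exact h1
  | succ b ih =>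
    obtain ⟨w, hw, hz⟩ := h2
    exact ⟨w, ih hw, hz⟩

theorem WW.single {o : V → V → Prop} {x y : V} (h : o x y) : WW o 1 x y := ⟨x, rfl, h⟩

theorem WW.mono {o o' : V → V → Prop} (h : ∀ x y, o x y → o' x y) {n : ℕ} {x y : V}
    (h1 : WW o n x y) : WW o' n x y := by
  induction n generalizing y with
  | zero => exact h1
  | succ n ih =>
    obtain ⟨w, hw, hz⟩ := h1
    exact ⟨w, ih hw, h _ _ hz⟩

theorem WW.flip {o : V → V → Prop} {n : ℕ} {x y : V}
    (h1 : WW o n x y) : WW (fun a b => o b a) n y x := by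
  induction n generalizing y with
  | zero => exact h1.symm
  | succ n ih =>
    obtain ⟨w, hw, hz⟩ := h1
    have h2 := WW.add (WW.single (o := fun a b => o b a) hz) (ih hw)
    rwa [Nat.add_comm] at h2

theorem WW.ofSeq {o : V → V → Prop} (f : ℕ → V) (i k : ℕ)
    (h : ∀ j, i ≤ j → j < i + k → o (f j) (f (j + 1))) : WW o k (f i) (f (i + k)) := by
  induction k with
  | zero => rfl
  | succ k ih =>
    exact ⟨f (i + k), ih (fun j h1 h2 => h j h1 (by omega)), h _ (by omega) (by omega)⟩

theorem WW.toSeq {o : V → V → Prop} {n : ℕ} {x y : V} (h : WW o n x y) :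
    ∃ f : ℕ → V, f 0 = x ∧ f n = y ∧ ∀ i < n, o (f i) (f (i + 1)) := by
  induction n generalizing y with
  | zero => exact ⟨fun _ => x, rfl, h, by simp⟩
  | succ n ih =>
    obtain ⟨w, hw, hz⟩ := h
    obtain ⟨f, h0, h1, h2⟩ := ih hw
    refine ⟨fun i => if i ≤ n then f i else y, by simpa using h0, by simp, ?_⟩
    intro i hi
    rcases Nat.lt_or_ge i n with h3 | h3
    · have h4 : i ≤ n := by omega
      have h5 : i + 1 ≤ n := by omega
      simpa [h4, h5] using h2 i h3
    · obtain rfl : i = n := by omega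
      simpa [h1] using hz

theorem WL.mono {o o' : V → V → Prop} (h : ∀ x y, o x y → o' x y) {n n' : ℕ} (hn : n ≤ n')
    {x y : V} (h1 : WL o n x y) : WL o' n' x y := by
  obtain ⟨m, hm, hw⟩ := h1
  exact ⟨m, by omega, hw.mono h⟩

theorem WL.le {o : V → V → Prop} {n n' : ℕ} {x y : V} (h1 : WL o n x y) (hn : n ≤ n') :
    WL o n' x y := h1.mono (fun _ _ h => h) hn

theorem WL.add {o : V → V → Prop} {a b c : ℕ} {x y z : V} (h1 : WL o a x y) (h2 : WL o b y z)
    (h : a + b ≤ c) : WL o c x z := by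
  obtain ⟨m, hm, hw⟩ := h1
  obtain ⟨k, hk, hv⟩ := h2
  exact ⟨m + k, by omega, hw.add hv⟩

theorem WL.flip {o : V → V → Prop} {n : ℕ} {x y : V}
    (h1 : WL o n x y) : WL (fun a b => o b a) n y x := by
  obtain ⟨m, hm, hw⟩ := h1
  exact ⟨m, hm, hw.flip⟩

theorem WL.dpath {o : V → V → Prop} {n : ℕ} {x y : V} (h : WL o n x y) : DPathLE o n x y := by
  classical
  obtain ⟨k, hk, hw⟩ := h
  have hex : ∃ m, WW o m x y := ⟨k, hw⟩
  have hle : Nat.find hex ≤ k := Nat.find_min' hex hw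
  have hmin : ∀ m, WW o m x y → Nat.find hex ≤ m := fun m hm => Nat.find_min' hex hm
  have hsp := Nat.find_spec hex
  generalize Nat.find hex = m at *
  obtain ⟨f, h0, h1, h2⟩ := hsp.toSeq
  have key : ∀ i j, i < j → j ≤ m → f i ≠ f j := by
    intro i j hij hj he
    have a := WW.ofSeq (o := o) f 0 i (fun t _ ht => h2 t (by omega))
    have b := WW.ofSeq (o := o) f j (m - j) (fun t _ ht => h2 t (by omega))
    rw [Nat.zero_add, h0, he] at a
    rw [show j + (m - j) = m by omega, h1] at b
    have := hmin _ (a.add b)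
    omega
  refine ⟨m, by omega, f, h0, h1, h2, ?_⟩
  intro i hi j hj he
  rcases Nat.lt_trichotomy i j with h | h | h
  · exact absurd he (key i j h hj)
  · exact h
  · exact absurd he.symm (key j i h hi)

/-- Partial orientation living on `H`. -/
def POr (G : SimpleGraph V) (H : Set V) (o : V → V → Prop) : Prop :=
  ∀ x y, o x y → G.Adj x y ∧ x ∈ H ∧ y ∈ H ∧ ¬ o y x

/-- Invariant at a vertex. -/
def VInv (G : SimpleGraph V) (u : V) (S : Set V) (D M : ℕ) (o : V → V → Prop) (v : V) : Prop :=
  (WL o (D + M) u v ∧ WL o (D + M) v u) ∧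
  ((∀ n, ∀ s ∈ S, WW G.Adj n s v → WL o (D + n) u v) ∨
    (∀ n, ∀ s ∈ S, WW G.Adj n s v → WL o (D + n) v u))

def EarInv (G : SimpleGraph V) (u : V) (S : Set V) (D M : ℕ) (H : Set V)
    (o : V → V → Prop) : Prop :=
  POr G H o ∧ S ⊆ H ∧ (∀ v ∈ S, WL o D u v ∧ WL o D v u) ∧ ∀ v ∈ H, VInv G u S D M o v

theorem EarInv.flip {G : SimpleGraph V} {u : V} {S : Set V} {D M : ℕ} {H : Set V}
    {o : V → V → Prop} (h : EarInv G u S D M H o) : EarInv G u S D M H (fun a b => o b a) := by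
  obtain ⟨h1, h2, h3, h4⟩ := h
  refine ⟨?_, h2, fun v hv => ⟨(h3 v hv).2.flip, (h3 v hv).1.flip⟩, ?_⟩
  · intro x y hxy
    obtain ⟨a, b, c, d⟩ := h1 y x hxy
    exact ⟨a.symm, c, b, d⟩
  · intro v hv
    obtain ⟨⟨b, c⟩, a | a⟩ := h4 v hv
    · exact ⟨⟨c.flip, b.flip⟩, Or.inr fun n s hs hw => (a n s hs hw).flip⟩
    · exact ⟨⟨c.flip, b.flip⟩, Or.inl fun n s hs hw => (a n s hs hw).flip⟩

/-- Adjacency avoiding the edge `{s, v}`. -/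
def QQ (G : SimpleGraph V) (s v : V) (x y : V) : Prop :=
  G.Adj x y ∧ ¬ (x = s ∧ y = v) ∧ ¬ (x = v ∧ y = s)

theorem QQ.symm {G : SimpleGraph V} {s v x y : V} (h : QQ G s v x y) : QQ G s v y x :=
  ⟨h.1.symm, fun ⟨a, b⟩ => h.2.2 ⟨b, a⟩, fun ⟨a, b⟩ => h.2.1 ⟨b, a⟩⟩

theorem QQ.wsymm {G : SimpleGraph V} {s v x y : V} {n : ℕ} (h : WW (QQ G s v) n x y) :
    WW (QQ G s v) n y x := h.flip.mono (fun _ _ h => QQ.symm h)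

theorem walk_split {G : SimpleGraph V} {S : Set V} {s v : V} (hs : s ∈ S) {n : ℕ} {t x : V}
    (ht : t ∈ S) (h : WW G.Adj n t x) :
    (∃ m ≤ n, ∃ t' ∈ S, WW (QQ G s v) m t' x) ∨ (∃ m, m + 1 ≤ n ∧ WW (QQ G s v) m v x) := by
  induction n generalizing x with
  | zero => exact Or.inl ⟨0, le_rfl, t, ht, h⟩
  | succ n ih =>
    obtain ⟨z, hz, hzx⟩ := h
    by_cases h1 : x = s
    · exact Or.inl ⟨0, by omega, s, hs, h1.symm⟩
    by_cases h2 : x = v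
    · exact Or.inr ⟨0, by omega, h2.symm⟩
    have hq : QQ G s v z x := ⟨hzx, fun h => h2 h.2, fun h => h1 h.2⟩
    rcases ih hz with ⟨m, hm, t', ht', hw⟩ | ⟨m, hm, hw⟩
    · exact Or.inl ⟨m + 1, by omega, t', ht', z, hw, hq⟩
    · exact Or.inr ⟨m + 1, by omega, z, hw, hq⟩

theorem walk_WW {G : SimpleGraph V} {s v a b : V} (p : G.Walk a b) (h : s(s, v) ∉ p.edges) :
    WW (QQ G s v) p.length a b := by
  induction p with
  | nil => rfl
  | cons hadj p ih =>
    rename_i a c b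
    simp only [Walk.edges_cons, List.mem_cons, not_or] at h
    have hq : QQ G s v a c := by
      refine ⟨hadj, ?_, ?_⟩
      · rintro ⟨rfl, rfl⟩; exact h.1 rfl
      · rintro ⟨rfl, rfl⟩; exact h.1 Sym2.eq_swap
    have := (WW.single hq).add (ih h.2)
    rwa [Nat.add_comm] at this

theorem trail_split {G : SimpleGraph V} {s v a b : V} (p : G.Walk a b) (hp : p.IsTrail)
    (he : s(s, v) ∈ p.edges) :
    ∃ l1 l2 x y, l1 + l2 + 1 = p.length ∧ WW (QQ G s v) l1 a x ∧ WW (QQ G s v) l2 y b ∧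
      ((x = s ∧ y = v) ∨ (x = v ∧ y = s)) := by
  induction p with
  | nil => simp at he
  | cons hadj p ih =>
    rename_i a c b
    rw [Walk.isTrail_cons] at hp
    by_cases h : s(s, v) = s(a, c)
    · refine ⟨0, p.length, a, c, by simp, rfl, walk_WW p (h ▸ hp.2), ?_⟩
      rcases Sym2.eq_iff.1 h with ⟨rfl, rfl⟩ | ⟨rfl, rfl⟩
      · exact Or.inl ⟨rfl, rfl⟩
      · exact Or.inr ⟨rfl, rfl⟩
    · have he' : s(s, v) ∈ p.edges := by
        rw [Walk.edges_cons, List.mem_cons] at he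
        exact he.resolve_left h
      obtain ⟨l1, l2, x, y, hl, h1, h2, h3⟩ := ih hp.1 he'
      have hq : QQ G s v a c := by
        refine ⟨hadj, ?_, ?_⟩
        · rintro ⟨rfl, rfl⟩; exact h rfl
        · rintro ⟨rfl, rfl⟩; exact h Sym2.eq_swap
      exact ⟨1 + l1, l2, x, y, by rw [Walk.length_cons]; omega, (WW.single hq).add h1, h2, h3⟩

theorem cycle_WW {G : SimpleGraph V} {s v : V} {η : ℕ} (h : InCycleLE G s(s, v) η) :
    ∃ n, n + 1 ≤ η ∧ WW (QQ G s v) n v s := by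
  obtain ⟨w, c, hc, he, hl⟩ := h
  obtain ⟨l1, l2, x, y, hl', h1, h2, h3⟩ := trail_split c hc.isTrail he
  refine ⟨l2 + l1, by omega, ?_⟩
  have h4 := h2.add h1
  rcases h3 with ⟨rfl, rfl⟩ | ⟨rfl, rfl⟩
  · exact h4
  · exact QQ.wsymm h4

/-- Adding one ear, oriented outward. -/
theorem ear_out {G : SimpleGraph V} {u : V} {S : Set V} {D M : ℕ} {H : Set V}
    {o : V → V → Prop} (h : EarInv G u S D M H o) {s : V} (hs : s ∈ S) (g : ℕ → V) (N j : ℕ)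
    (hN : N ≤ M) (hj : j ≤ N) (hsv : G.Adj s (g 0)) (hstep : ∀ i < N, QQ G s (g 0) (g i) (g (i + 1)))
    (hinj : ∀ i k, i < k → k ≤ N → g i ≠ g k) (hjH : g j ∈ H) (hlt : ∀ i < j, g i ∉ H)
    (h0 : g 0 ∉ H)
    (hdist : ∀ i ≤ N, ∀ n, ∀ t ∈ S, WW G.Adj n t (g i) → i + 1 ≤ n ∨ N - i ≤ n)
    (hback : WL o (D + (N - j)) (g j) u) :
    ∃ o', EarInv G u S D M (H ∪ {x | ∃ i < j, x = g i}) o' := by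
  obtain ⟨h1, h2, h3, h4⟩ := h
  have hsH := h2 hs
  have hj0 : 0 < j := by
    rcases Nat.eq_zero_or_pos j with h | h
    · subst h; exact absurd hjH h0
    · exact h
  have hinj' : ∀ i k, i ≤ N → k ≤ N → g i = g k → i = k := by
    intro i k hi hk he
    rcases Nat.lt_trichotomy i k with h | h | h
    · exact absurd he (hinj i k h hk)
    · exact h
    · exact absurd he.symm (hinj k i h hi)
  let o' : V → V → Prop := fun x y => o x y ∨ (x = s ∧ y = g 0) ∨ ∃ i < j, x = g i ∧ y = g (i + 1)
  have hoo : ∀ x y, o x y → o' x y := fun x y h => Or.inl h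
  have hSW : ∀ v ∈ S, WL o' D u v ∧ WL o' D v u := fun v hv =>
    ⟨(h3 v hv).1.mono hoo le_rfl, (h3 v hv).2.mono hoo le_rfl⟩
  refine ⟨o', ?_, fun x hx => Or.inl (h2 hx), hSW, ?_⟩
  · intro x y hxy
    have hmem : ∀ i ≤ j, g i ∈ H ∪ {x | ∃ i < j, x = g i} := by
      intro i hi
      rcases Nat.lt_or_ge i j with h | h
      · exact Or.inr ⟨i, h, rfl⟩
      · obtain rfl : i = j := by omega
        exact Or.inl hjH
    rcases hxy with hxy | ⟨rfl, rfl⟩ | ⟨i, hi, rfl, rfl⟩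
    · obtain ⟨a, b, c, d⟩ := h1 x y hxy
      refine ⟨a, Or.inl b, Or.inl c, ?_⟩
      rintro (e | ⟨rfl, rfl⟩ | ⟨i, hi, rfl, rfl⟩)
      · exact d e
      · exact h0 b
      · exact hlt i hi c
    · refine ⟨hsv, Or.inl hsH, hmem 0 (by omega), ?_⟩
      rintro (e | ⟨e1, e2⟩ | ⟨i, hi, e1, e2⟩)
      · exact h0 (h1 _ _ e).2.1
      · exact h0 (e1 ▸ hsH)
      · have := hinj' 0 i (by omega) (by omega) e1
        subst this
        exact (hstep 0 (by omega)).2.2 ⟨rfl, e2.symm⟩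
    · refine ⟨(hstep i (by omega)).1, hmem i (by omega), hmem (i + 1) (by omega), ?_⟩
      rintro (e | ⟨e1, e2⟩ | ⟨k, hk, e1, e2⟩)
      · exact hlt i hi (h1 _ _ e).2.2.1
      · exact (hstep i (by omega)).2.2 ⟨e2, e1⟩
      · have a := hinj' _ _ (by omega) (by omega) e1
        have b := hinj' _ _ (by omega) (by omega) e2
        omega
  · rintro v (hv | ⟨i, hi, rfl⟩)
    · obtain ⟨⟨b, c⟩, a | a⟩ := h4 v hv
      · exact ⟨⟨b.mono hoo le_rfl, c.mono hoo le_rfl⟩,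
          Or.inl fun n s hs hw => (a n s hs hw).mono hoo le_rfl⟩
      · exact ⟨⟨b.mono hoo le_rfl, c.mono hoo le_rfl⟩,
          Or.inr fun n s hs hw => (a n s hs hw).mono hoo le_rfl⟩
    · have hst : ∀ k < j, o' (g k) (g (k + 1)) := fun k hk => Or.inr (Or.inr ⟨k, hk, rfl, rfl⟩)
      have a1 := WW.ofSeq (o := o') g 0 i (fun k _ hk => hst k (by omega))
      rw [Nat.zero_add] at a1
      have a2 : WW o' (1 + i) s (g i) :=
        (WW.single (o := o') (Or.inr (Or.inl ⟨rfl, rfl⟩))).add a1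
      have hout : WL o' (D + (i + 1)) u (g i) :=
        (hSW s hs).1.add ⟨_, le_rfl, a2⟩ (by omega)
      have b1 := WW.ofSeq (o := o') g i (j - i) (fun k _ hk => hst k (by omega))
      rw [show i + (j - i) = j by omega] at b1
      have hin : WL o' (D + (N - i)) (g i) u :=
        WL.add ⟨_, le_rfl, b1⟩ (hback.mono hoo le_rfl) (by omega)
      refine ⟨⟨hout.le (by omega), hin.le (by omega)⟩, ?_⟩
      by_cases hc : i + 1 ≤ N - i
      · refine Or.inl fun n t ht hw => hout.le ?_
        have := hdist i (by omega) n t ht hw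
        omega
      · refine Or.inr fun n t ht hw => hin.le ?_
        have := hdist i (by omega) n t ht hw
        omega

theorem ear_step {G : SimpleGraph V} {u : V} {S : Set V} {D ρ η : ℕ} {H : Set V}
    {o : V → V → Prop} (hcyc : ∀ e ∈ G.edgeSet, InCycleLE G e η)
    (hρ : ∀ v, ∃ s ∈ S, WL G.Adj ρ s v)
    (h : EarInv G u S D (min (2 * ρ) (η - 1)) H o) {s v : V} (hs : s ∈ S)
    (hv : v ∉ H) (hadj : G.Adj s v) :
    ∃ H' o', H ⊆ H' ∧ v ∈ H' ∧ EarInv G u S D (min (2 * ρ) (η - 1)) H' o' := by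
  classical
  obtain ⟨n0, hn0, hw0⟩ := cycle_WW (hcyc s(s, v) hadj)
  have hex : ∃ n, ∃ t ∈ S, WW (QQ G s v) n v t := ⟨n0, s, hs, hw0⟩
  have hNle : Nat.find hex ≤ n0 := Nat.find_min' hex ⟨s, hs, hw0⟩
  have hmin : ∀ m, ∀ t ∈ S, WW (QQ G s v) m v t → Nat.find hex ≤ m :=
    fun m t ht hm => Nat.find_min' hex ⟨t, ht, hm⟩
  have hsp := Nat.find_spec hex
  generalize Nat.find hex = N at *
  obtain ⟨t, ht, hw⟩ := hsp
  obtain ⟨g, hg0, hgN, hstep⟩ := hw.toSeq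
  subst hg0
  have hpre : ∀ i ≤ N, WW (QQ G s (g 0)) i (g 0) (g i) := by
    intro i hi
    have a := WW.ofSeq (o := QQ G s (g 0)) g 0 i (fun t _ ht => hstep t (by omega))
    rwa [Nat.zero_add] at a
  have hpost : ∀ i ≤ N, WW (QQ G s (g 0)) (N - i) (g i) t := by
    intro i hi
    have a := WW.ofSeq (o := QQ G s (g 0)) g i (N - i) (fun t _ ht => hstep t (by omega))
    rwa [show i + (N - i) = N by omega, hgN] at a
  have hinj : ∀ i k, i < k → k ≤ N → g i ≠ g k := by
    intro i k hik hk he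
    have a := hpre i (by omega)
    rw [he] at a
    have := hmin _ t ht (a.add (hpost k hk))
    omega
  have hdist : ∀ i ≤ N, ∀ n, ∀ t ∈ S, WW G.Adj n t (g i) → i + 1 ≤ n ∨ N - i ≤ n := by
    intro i hi n t' ht' hw'
    rcases walk_split (v := g 0) hs ht' hw' with ⟨m, hm, t'', ht'', hw''⟩ | ⟨m, hm, hw''⟩
    · have := hmin _ t'' ht'' ((hpre i hi).add (QQ.wsymm hw''))
      omega
    · have := hmin _ t ht (hw''.add (hpost i hi))
      omega
  have hNρ : N ≤ 2 * ρ := by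
    by_contra hc
    obtain ⟨t', ht', m, hm, hw'⟩ := hρ (g ρ)
    have := hdist ρ (by omega) m t' ht' hw'
    omega
  obtain ⟨h1, h2, h3, h4⟩ := id h
  have hexj : ∃ j, g j ∈ H := ⟨N, hgN ▸ h2 ht⟩
  have hjN : Nat.find hexj ≤ N := Nat.find_min' hexj (hgN ▸ h2 ht)
  have hjH := Nat.find_spec hexj
  have hlt : ∀ i < Nat.find hexj, g i ∉ H := fun i hi => Nat.find_min hexj hi
  generalize Nat.find hexj = j at *
  have hNM : N ≤ min (2 * ρ) (η - 1) := by omega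
  have hj0 : 0 < j := by
    rcases Nat.eq_zero_or_pos j with h | h
    · subst h; exact absurd hjH hv
    · exact h
  have hret : WW G.Adj (N - j) t (g j) :=
    (QQ.wsymm (hpost j hjN)).mono (fun _ _ h => h.1)
  obtain ⟨_, a | a⟩ := h4 _ hjH
  · obtain ⟨o', ho'⟩ := ear_out h.flip hs g N j hNM hjN hadj hstep hinj hjH hlt hv hdist
      (a _ t ht hret).flip
    exact ⟨H ∪ {x | ∃ i < j, x = g i}, o', Set.subset_union_left, Or.inr ⟨0, hj0, rfl⟩, ho'⟩
  · obtain ⟨o', ho'⟩ := ear_out h hs g N j hNM hjN hadj hstep hinj hjH hlt hv hdist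
      (a _ t ht hret)
    exact ⟨H ∪ {x | ∃ i < j, x = g i}, o', Set.subset_union_left, Or.inr ⟨0, hj0, rfl⟩, ho'⟩

theorem stage [Fintype V] {G : SimpleGraph V} {u : V} {S : Set V} {D ρ η : ℕ}
    {o : V → V → Prop} (hcyc : ∀ e ∈ G.edgeSet, InCycleLE G e η)
    (hρ : ∀ v, ∃ s ∈ S, WL G.Adj ρ s v) (hP : POr G S o)
    (hS : ∀ v ∈ S, WL o D u v ∧ WL o D v u) :
    ∃ S' o', S ⊆ S' ∧ (∀ s ∈ S, ∀ v, G.Adj s v → v ∈ S') ∧ POr G S' o' ∧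
      ∀ v ∈ S', WL o' (D + min (2 * ρ) (η - 1)) u v ∧ WL o' (D + min (2 * ρ) (η - 1)) v u := by
  classical
  have hbase : EarInv G u S D (min (2 * ρ) (η - 1)) S o := by
    refine ⟨hP, subset_rfl, hS, fun v hv => ⟨⟨(hS v hv).1.le (by omega),
      (hS v hv).2.le (by omega)⟩, Or.inl fun n _ _ _ => (hS v hv).1.le (by omega)⟩⟩
  obtain ⟨H, hH⟩ := (Set.toFinite {H : Set V | ∃ o, EarInv G u S D (min (2 * ρ) (η - 1)) H o}
    ).exists_maximal ⟨S, o, hbase⟩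
  obtain ⟨o', ho'⟩ := hH.prop
  have hN : ∀ s ∈ S, ∀ v, G.Adj s v → v ∈ H := by
    intro s hs v hadj
    by_contra hv
    obtain ⟨H', o'', hsub, hvH, hI⟩ := ear_step hcyc hρ ho' hs hv hadj
    exact hv (hH.le_of_ge (show H' ∈ {H : Set V | _} from ⟨o'', hI⟩) hsub hvH)
  exact ⟨H, o', ho'.2.1, hN, ho'.1, fun v hv => (ho'.2.2.2 v hv).1⟩

theorem all_stages [Fintype V] {G : SimpleGraph V} {u : V} {η : ℕ}
    (hcyc : ∀ e ∈ G.edgeSet, InCycleLE G e η) (ρ : ℕ) :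
    ∀ (S : Set V) (D : ℕ) (o : V → V → Prop), (∀ v, ∃ s ∈ S, WL G.Adj ρ s v) → POr G S o →
    (∀ v ∈ S, WL o D u v ∧ WL o D v u) →
    ∃ o', POr G Set.univ o' ∧ ∀ v,
      WL o' (D + ∑ i ∈ Finset.Icc 1 ρ, min (2 * i) (η - 1)) u v ∧
      WL o' (D + ∑ i ∈ Finset.Icc 1 ρ, min (2 * i) (η - 1)) v u := by
  induction ρ with
  | zero =>
    intro S D o hρ hP hS
    have hall : ∀ v, v ∈ S := by
      intro v
      obtain ⟨s, hs, m, hm, hw⟩ := hρ v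
      obtain rfl : m = 0 := by omega
      cases hw
      exact hs
    refine ⟨o, fun x y hxy => ?_, fun v => by simpa using hS v (hall v)⟩
    obtain ⟨a, b, c, d⟩ := hP x y hxy
    exact ⟨a, trivial, trivial, d⟩
  | succ ρ ih =>
    intro S D o hρ hP hS
    obtain ⟨S', o', hsub, hnb, hP', hS'⟩ := stage hcyc hρ hP hS
    have hnew : ∀ v, ∃ s ∈ S', WL G.Adj ρ s v := by
      intro v
      obtain ⟨s, hs, m, hm, hw⟩ := hρ v
      obtain ⟨f, h0, hm1, hst⟩ := hw.toSeq
      rcases Nat.eq_zero_or_pos m with h | h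
      · subst h
        exact ⟨s, hsub hs, 0, by omega, hw⟩
      · refine ⟨f 1, hnb s hs _ (h0 ▸ hst 0 h), m - 1, by omega, ?_⟩
        have a := WW.ofSeq (o := G.Adj) f 1 (m - 1) (fun t _ ht => hst t (by omega))
        rwa [show 1 + (m - 1) = m by omega, hm1] at a
    obtain ⟨o'', h1, h2⟩ := ih S' _ o' hnew hP' hS'
    refine ⟨o'', h1, fun v => ?_⟩
    rw [Finset.sum_Icc_succ_top (by omega), Nat.add_comm (∑ i ∈ Finset.Icc 1 ρ, _),
      ← Nat.add_assoc]
    exact h2 v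

theorem Walk_toWW {G : SimpleGraph V} {a b : V} (p : G.Walk a b) : WW G.Adj p.length a b := by
  induction p with
  | nil => rfl
  | cons hadj p ih =>
    have := (WW.single hadj).add ih
    rwa [Nat.add_comm] at this


/-- A bridgeless connected graph with radius at most `r` in which every
edge lies on a cycle of length at most `η` admits an orientation of radius at most
`∑_{i=1}^{r} min (2i) (η-1)`; in particular, one of radius at most `r * (η - 1)`. -/
theorem oriented_radius_bound [Fintype V] (G : SimpleGraph V)
    (hconn : G.Connected) (hbl : Bridgeless G)
    (r : ℕ) (hr : 1 ≤ r) (u : V) (hu : ∀ v : V, G.dist u v ≤ r)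
    (η : ℕ) (hη : 3 ≤ η) (hcyc : ∀ e ∈ G.edgeSet, InCycleLE G e η) :
    OrientRadiusLE G (∑ i ∈ Finset.Icc 1 r, min (2 * i) (η - 1)) ∧
      OrientRadiusLE G (r * (η - 1)) := by
  have main : OrientRadiusLE G (∑ i ∈ Finset.Icc 1 r, min (2 * i) (η - 1)) := by
    classical
    obtain ⟨o, hP, ho⟩ := all_stages (u := u) hcyc r {u} 0 (fun _ _ => False) (by
      intro v
      obtain ⟨p, hp⟩ := hconn.exists_walk_length_eq_dist u v
      exact ⟨u, rfl, p.length, hp ▸ hu v, Walk_toWW p⟩) (by intro x y h; exact h.elim) (by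
      rintro v rfl
      exact ⟨⟨0, le_rfl, rfl⟩, ⟨0, le_rfl, rfl⟩⟩)
    let e := Fintype.equivFin V
    have hoo : ∀ x y, o x y → (o x y ∨ (G.Adj x y ∧ ¬ o y x ∧ e x < e y)) :=
      fun x y h => Or.inl h
    refine ⟨fun x y => o x y ∨ (G.Adj x y ∧ ¬ o y x ∧ e x < e y), ⟨?_, ?_, ?_⟩, u, fun v => ?_⟩
    · rintro x y (h | h)
      · exact (hP x y h).1
      · exact h.1
    · intro x y h
      by_cases h1 : o x y
      · exact Or.inl (Or.inl h1)
      by_cases h2 : o y x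
      · exact Or.inr (Or.inl h2)
      rcases lt_trichotomy (e x) (e y) with h3 | h3 | h3
      · exact Or.inl (Or.inr ⟨h, h2, h3⟩)
      · exact absurd (e.injective h3) h.ne
      · exact Or.inr (Or.inr ⟨h.symm, h1, h3⟩)
    · rintro x y (h | h) (h' | h')
      · exact (hP x y h).2.2.2 h'
      · exact h'.2.1 h
      · exact h.2.1 h'
      · exact lt_asymm h.2.2 h'.2.2
    · exact ⟨((ho v).1.mono hoo (by omega)).dpath, ((ho v).2.mono hoo (by omega)).dpath⟩
  refine ⟨main, ?_⟩
  have hle : ∑ i ∈ Finset.Icc 1 r, min (2 * i) (η - 1) ≤ r * (η - 1) := by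
    calc _ ≤ ∑ i ∈ Finset.Icc 1 r, (η - 1) := Finset.sum_le_sum fun i _ => min_le_right _ _
      _ = r * (η - 1) := by simp
  obtain ⟨o, h1, w, h2⟩ := main
  refine ⟨o, h1, w, fun v => ?_⟩
  obtain ⟨⟨m, hm, f⟩, ⟨m', hm', f'⟩⟩ := h2 v
  exact ⟨⟨m, hm.trans hle, f⟩, ⟨m', hm'.trans hle, f'⟩⟩
end

section
/- Let G be a finite connected bridgeless graph, let r ≥ 1 be an integer such that some vertex u of G satisfies d_G(u,v) ≤ r for every vertex v (i.e., rad(G) ≤ r), and let η ≥ 3 be an integer such that every edge of G is contained in a cycle of length at most η. Then G admits a rainbow coloring with Σ_{i=1}^{r} min{2i+1, η} colors; in particular, rc(G) ≤ r·η. -/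
open SimpleGraph Finset

variable {V : Type*}

theorem rb_split {G : SimpleGraph V} {a b : V} (p : G.Walk a b) (x y : V) (h : s(x, y) ∈ p.edges) :
    ∃ (x' y' : V) (p₁ : G.Walk a x') (p₂ : G.Walk y' b), s(x', y') = s(x, y) ∧
      p.edges = p₁.edges ++ s(x, y) :: p₂.edges := by
  induction p with
  | nil => simp at h
  | @cons a c b hac p ih =>
    rw [Walk.edges_cons, List.mem_cons] at h
    rcases h with h | h
    · exact ⟨a, c, Walk.nil, p, h.symm, by simp [h]⟩
    · obtain ⟨x', y', p₁, p₂, h1, h2⟩ := ih h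
      exact ⟨x', y', Walk.cons hac p₁, p₂, h1, by simp [h2]⟩

theorem rb_detour {G : SimpleGraph V} {x y : V} {η : ℕ} (h : InCycleLE G s(x, y) η) :
    ∃ p : G.Walk x y, s(x, y) ∉ p.edges ∧ p.length + 1 ≤ η := by
  obtain ⟨v, c, hc, he, hl⟩ := h
  obtain ⟨x', y', p₁, p₂, h1, h2⟩ := rb_split c x y he
  have hn := hc.isTrail.edges_nodup
  have hlen : c.length = p₁.length + p₂.length + 1 := by
    have := congrArg List.length h2
    simp at this
    omega
  rw [h2] at hn
  have hne : s(x, y) ∉ (p₂.append p₁).edges := by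
    rw [Walk.edges_append, List.mem_append]
    rw [List.nodup_append] at hn
    rintro (h | h)
    · exact (List.nodup_cons.1 hn.2.1).1 h
    · exact hn.2.2 _ h _ (List.mem_cons_self) rfl
  have hl2 : (p₂.append p₁).length + 1 ≤ η := by
    rw [Walk.length_append]; omega
  rcases Sym2.eq_iff.1 h1 with ⟨rfl, rfl⟩ | ⟨rfl, rfl⟩
  · exact ⟨(p₂.append p₁).reverse, by rwa [Walk.edges_reverse, List.mem_reverse],
      by rwa [Walk.length_reverse]⟩
  · exact ⟨p₂.append p₁, hne, hl2⟩

theorem rb_indep [Fintype V] (R : V → V → Prop) (hs : ∀ x y, R x y → R y x) :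
    ∃ l : V → Prop, ∀ x, (∃ y, R x y ∧ x ≠ y) → ∃ z, R x z ∧ (l x ↔ ¬ l z) := by
  classical
  obtain ⟨S, hS⟩ := (Set.toFinite {S : Set V | ∀ x ∈ S, ∀ y ∈ S, x ≠ y → ¬ R x y}).exists_maximal
    ⟨∅, by simp⟩
  refine ⟨fun x => x ∈ S, fun x ⟨y, hxy, hne⟩ => ?_⟩
  by_cases hx : x ∈ S
  · refine ⟨y, hxy, ?_⟩
    have : y ∉ S := fun hy => hS.1 x hx y hy hne hxy
    simp [hx, this]
  · by_contra hcon
    push Not at hcon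
    have hz : ∀ z ∈ S, ¬ R x z := fun z hz hR => by
      rcases hcon z hR with h | h
      · exact hx h.1
      · exact h.2 hz
    have hins : insert x S ∈ {S : Set V | ∀ x ∈ S, ∀ y ∈ S, x ≠ y → ¬ R x y} := by
      intro a ha b hb hab
      rcases Set.mem_insert_iff.1 ha with rfl | ha <;> rcases Set.mem_insert_iff.1 hb with rfl | hb
      · exact absurd rfl hab
      · exact hz b hb
      · exact fun h => hz a (by assumption) (hs _ _ h)
      · exact hS.1 a ha b hb hab
    exact hx (hS.2 hins (Set.subset_insert x S) (Set.mem_insert x S))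

theorem rb_level {G : SimpleGraph V} (hconn : G.Connected) (D : Set V) (k : ℕ)
    (hk : ∀ v, ∃ a ∈ D, G.dist a v ≤ k) :
    ∃ (d : V → ℕ) (π : V → V), (∀ v, d v = 0 ↔ v ∈ D) ∧ (∀ v w, G.Adj v w → d v ≤ d w + 1) ∧
      (∀ v, d v ≠ 0 → G.Adj v (π v) ∧ d v = d (π v) + 1) ∧ (∀ v, d v ≤ k) := by
  classical
  have hex : ∀ v, ∃ n, ∃ a ∈ D, G.dist a v ≤ n := fun v => ⟨k, hk v⟩
  let d : V → ℕ := fun v => Nat.find (hex v)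
  have hd : ∀ v, ∃ a ∈ D, G.dist a v ≤ d v := fun v => Nat.find_spec (hex v)
  have hmin : ∀ v n, (∃ a ∈ D, G.dist a v ≤ n) → d v ≤ n := fun v n h => Nat.find_min' (hex v) h
  have hadj : ∀ v w, G.Adj v w → d v ≤ d w + 1 := by
    intro v w h
    obtain ⟨a, ha, hl⟩ := hd w
    refine hmin _ _ ⟨a, ha, ?_⟩
    have := hconn.dist_triangle (u := a) (v := w) (w := v)
    have h1 : G.dist w v = 1 := SimpleGraph.dist_eq_one_iff_adj.2 h.symm
    omega
  have hpar : ∀ v, d v ≠ 0 → ∃ w, G.Adj v w ∧ d v = d w + 1 := by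
    intro v hv
    obtain ⟨a, ha, hl⟩ := hd v
    obtain ⟨p, hp⟩ := (hconn v a).exists_walk_length_eq_dist
    cases p with
    | nil =>
      have := hmin v 0 ⟨_, ha, by simp⟩
      omega
    | @cons _ w _ h p =>
      refine ⟨w, h, le_antisymm (hadj _ _ h) ?_⟩
      have h1 : d w ≤ p.length := hmin _ _ ⟨a, ha, by rw [SimpleGraph.dist_comm]; exact SimpleGraph.dist_le p⟩
      rw [Walk.length_cons, SimpleGraph.dist_comm] at hp
      omega
  choose! π hπ using hpar
  refine ⟨d, π, fun v => ⟨fun h => ?_, fun h => ?_⟩, hadj, hπ, fun v => hmin _ _ (hk v)⟩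
  · obtain ⟨a, ha, hl⟩ := hd v
    have : G.dist a v = 0 := by omega
    rw [hconn.dist_eq_zero_iff] at this
    exact this ▸ ha
  · exact Nat.le_zero.1 (hmin v 0 ⟨v, h, by simp⟩)

theorem rb_exit {G : SimpleGraph V} (d : V → ℕ) (hadj : ∀ v w, G.Adj v w → d v ≤ d w + 1)
    (T : V → Prop) {a b : V} (p : G.Walk a b) (hb : d b = 0) (ha : T a) (hbT : ¬ T b) :
    ∃ w z, s(w, z) ∈ p.edges ∧ T w ∧ ¬ T z ∧ d w + d z + 1 ≤ d a + p.length := by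
  have hlen : ∀ {a b : V} (p : G.Walk a b), d b = 0 → d a ≤ p.length := by
    intro a b p hb
    induction p with
    | nil => simp [hb]
    | cons h p ih =>
      have := ih hb
      have := hadj _ _ h
      simp; omega
  induction p with
  | nil => exact absurd ha hbT
  | @cons a c b h p ih =>
    by_cases hc : T c
    · obtain ⟨w, z, h1, h2, h3, h4⟩ := ih hb hc hbT
      refine ⟨w, z, by simp [h1], h2, h3, ?_⟩
      have := hadj _ _ h.symm
      simp; omega
    · refine ⟨a, c, by simp, ha, hc, ?_⟩
      have := hlen p hb
      simp; omega

theorem rb_ears [Fintype V] {G : SimpleGraph V} (d : V → ℕ) (π : V → V)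
    (hadj : ∀ v w, G.Adj v w → d v ≤ d w + 1)
    (hπ : ∀ v, d v ≠ 0 → G.Adj v (π v) ∧ d v = d (π v) + 1) (k η : ℕ) (hk : ∀ v, d v ≤ k)
    (hk1 : 1 ≤ k) (hη : 3 ≤ η) (hcyc : ∀ e ∈ G.edgeSet, InCycleLE G e η) (m : ℕ)
    (hm : m = min (2 * k + 1) η) :
    ∃ nc : Sym2 V → ℕ, (∀ e, nc e < m) ∧ ∀ x, d x = 1 → ∃ (a b : V) (q : G.Walk a b),
      d a = 0 ∧ d b = 0 ∧ x ∈ q.support ∧ (∀ e ∈ q.edges, ∃ z ∈ e, d z ≠ 0) ∧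
      (q.edges.map nc).Pairwise (· < ·) := by
  classical
  let root : V → V := fun v => π^[d v - 1] v
  have hroot1 : ∀ v, d v = 1 → root v = v := fun v hv => by simp [root, hv]
  have hrootp : ∀ v, d v ≠ 0 → d (π v) ≠ 0 → root (π v) = root v := by
    intro v hv hp
    have h := (hπ v hv).2
    obtain ⟨n, hn⟩ : ∃ n, d (π v) = n + 1 := ⟨d (π v) - 1, by omega⟩
    have h2 : d v = n + 2 := by omega
    simp [root, hn, h2]
  let R : V → V → Prop := fun x x' => ∃ w w', G.Adj w w' ∧ d w ≠ 0 ∧ d w' ≠ 0 ∧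
    root w = x ∧ root w' = x' ∧ d w + d w' + 1 ≤ m
  obtain ⟨l, hl⟩ := rb_indep R (by
    rintro x y ⟨w, w', h1, h2, h3, h4, h5, h6⟩
    exact ⟨w', w, h1.symm, h3, h2, h5, h4, by omega⟩)
  let P : V → V → Prop := fun v w => d v ≠ 0 ∧ (w = π v ∨ d w = 0 ∨ (l (root v) ∧ ¬ l (root w)))
  have hP : ∀ v w, P v w → ¬ P w v := by
    rintro v w ⟨hv, h1⟩ ⟨hw, h2⟩
    have hv' := hπ v hv
    have hw' := hπ w hw
    have e1 := hrootp v hv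
    have e2 := hrootp w hw
    rcases h1 with rfl | h1 | h1
    · rcases h2 with h2 | h2 | h2
      · rw [← h2] at hw'; omega
      · exact hv h2
      · rw [e1 hw] at h2; exact h2.2 h2.1
    · exact hw h1
    · rcases h2 with rfl | h2 | h2
      · rw [e2 hv] at h1; exact h1.2 h1.1
      · exact hv h2
      · exact h2.2 h1.1
  let g : V → V → ℕ := fun v w => if w = π v then (if l (root v) then d v - 1 else m - d v)
    else if d w = 0 then (if l (root v) then m - 1 else 0) else d v
  let F : V → V → ℕ := fun v w => min (m - 1) (if P v w then g v w else if P w v then g w v else 0)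
  have hF : ∀ v w, F v w = F w v := by
    intro v w
    have h1 := hP v w
    simp only [F]
    by_cases h : P v w
    · simp [h, h1 h]
    · simp [h]
  let nc : Sym2 V → ℕ := Sym2.lift ⟨F, hF⟩
  have hncP : ∀ v w, P v w → nc s(v, w) = min (m - 1) (g v w) := by
    intro v w h
    simp [nc, F, h]
  have hm3 : 3 ≤ m := by omega
  have nc_up : ∀ v, d v ≠ 0 → nc s(v, π v) = min (m - 1) (if l (root v) then d v - 1 else m - d v) := by
    intro v hv
    rw [hncP v (π v) ⟨hv, Or.inl rfl⟩]; simp [g]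
  have nc_side : ∀ v w, d v ≠ 0 → d w = 0 → w ≠ π v →
      nc s(v, w) = if l (root v) then m - 1 else 0 := by
    intro v w hv hw hne
    rw [hncP v w ⟨hv, Or.inr (Or.inl hw)⟩]
    simp only [g, hne, hw, if_true, if_false]
    split_ifs <;> simp
  have nc_cross : ∀ v w, d v ≠ 0 → d w ≠ 0 → l (root v) → ¬ l (root w) →
      nc s(v, w) = min (m - 1) (d v) := by
    intro v w hv hw hlv hlw
    rw [hncP v w ⟨hv, Or.inr (Or.inr ⟨hlv, hlw⟩)⟩]
    have hne : w ≠ π v := by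
      rintro rfl
      rw [hrootp v hv hw] at hlw; exact hlw hlv
    simp [g, hne, hw]
  have upA : ∀ n v, d v = n + 1 → n + 1 ≤ m → l (root v) → ∃ (a : V) (q : G.Walk a v), d a = 0 ∧
      root v ∈ q.support ∧ (∀ e ∈ q.edges, ∃ z ∈ e, d z ≠ 0) ∧
      (q.edges.map nc).Pairwise (· < ·) ∧ ∀ c ∈ q.edges.map nc, c < n + 1 := by
    intro n
    induction n with
    | zero =>
      intro v hv hnm hlv
      obtain ⟨h1, h2⟩ := hπ v (by omega)
      refine ⟨π v, Walk.cons h1.symm Walk.nil, by omega, by simp [hroot1 v hv], ?_, by simp, ?_⟩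
      · simp; right; omega
      · have := nc_up v (by omega)
        simp [Sym2.eq_swap (a := π v)]
        rw [this]; simp [hlv, hv]
    | succ n ih =>
      intro v hv hnm hlv
      obtain ⟨h1, h2⟩ := hπ v (by omega)
      have hr := hrootp v (by omega) (by omega)
      obtain ⟨a, q, q1, q2, q3, q4, q5⟩ := ih (π v) (by omega) (by omega) (by rw [hr]; exact hlv)
      have hc : nc s(π v, v) = n + 1 := by
        rw [Sym2.eq_swap, nc_up v (by omega)]; simp [hlv, hv]; omega
      refine ⟨a, q.concat h1.symm, q1, ?_, ?_, ?_, ?_⟩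
      · rw [hr] at q2; simp [Walk.support_concat, q2]
      · intro e he
        simp only [Walk.edges_concat, List.concat_eq_append, List.mem_append, List.mem_singleton] at he
        rcases he with he | rfl
        · exact q3 e he
        · exact ⟨v, by simp, by omega⟩
      · simp only [Walk.edges_concat, List.concat_eq_append, List.map_append, List.pairwise_append]
        refine ⟨q4, by simp, ?_⟩
        intro c hc' c' hc2
        simp [hc] at hc2
        rw [hc2]; exact q5 c hc'
      · intro c hc'
        simp only [Walk.edges_concat, List.concat_eq_append, List.map_append, List.mem_append] at hc'
        rcases hc' with h | h
        · have := q5 c h; omega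
        · simp [hc] at h; omega
  have upB : ∀ n v, d v = n + 1 → n + 1 ≤ m → ¬ l (root v) → ∃ (a : V) (q : G.Walk v a), d a = 0 ∧
      root v ∈ q.support ∧ (∀ e ∈ q.edges, ∃ z ∈ e, d z ≠ 0) ∧
      (q.edges.map nc).Pairwise (· < ·) ∧ ∀ c ∈ q.edges.map nc, m - (n + 1) ≤ c := by
    intro n
    induction n with
    | zero =>
      intro v hv hnm hlv
      obtain ⟨h1, h2⟩ := hπ v (by omega)
      refine ⟨π v, Walk.cons h1 Walk.nil, by omega, by simp [hroot1 v hv], ?_, by simp, ?_⟩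
      · simp; left; omega
      · have := nc_up v (by omega)
        simp
        rw [this]; simp [hlv, hv]; omega
    | succ n ih =>
      intro v hv hnm hlv
      obtain ⟨h1, h2⟩ := hπ v (by omega)
      have hr := hrootp v (by omega) (by omega)
      obtain ⟨a, q, q1, q2, q3, q4, q5⟩ := ih (π v) (by omega) (by omega) (by rw [hr]; exact hlv)
      have hc : nc s(v, π v) = m - (n + 2) := by
        rw [nc_up v (by omega)]; simp [hlv, hv]; omega
      refine ⟨a, Walk.cons h1 q, q1, ?_, ?_, ?_, ?_⟩
      · rw [hr] at q2; simp [q2]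
      · intro e he
        simp only [Walk.edges_cons, List.mem_cons] at he
        rcases he with rfl | he
        · exact ⟨v, by simp, by omega⟩
        · exact q3 e he
      · rw [Walk.edges_cons, List.map_cons, List.pairwise_cons]
        refine ⟨?_, q4⟩
        intro c hc'
        have := q5 c hc'
        omega
      · intro c hc'
        rw [Walk.edges_cons, List.map_cons, List.mem_cons] at hc'
        rcases hc' with h | h
        · omega
        · have := q5 c h; omega
  -- full ears across an edge
  have cross : ∀ w w', G.Adj w w' → d w ≠ 0 → d w' ≠ 0 → l (root w) → ¬ l (root w') →
      d w + d w' + 1 ≤ m → ∃ (a b : V) (q : G.Walk a b),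
      d a = 0 ∧ d b = 0 ∧ root w ∈ q.support ∧ root w' ∈ q.support ∧
      (∀ e ∈ q.edges, ∃ z ∈ e, d z ≠ 0) ∧ (q.edges.map nc).Pairwise (· < ·) := by
    intro w w' h hw hw' hlw hlw' hle
    obtain ⟨a, q, q1, q2, q3, q4, q5⟩ := upA (d w - 1) w (by omega) (by omega) hlw
    obtain ⟨b, p, p1, p2, p3, p4, p5⟩ := upB (d w' - 1) w' (by omega) (by omega) hlw'
    have hc : nc s(w, w') = d w := by rw [nc_cross w w' hw hw' hlw hlw']; omega
    refine ⟨a, b, q.append (Walk.cons h p), q1, p1, ?_, ?_, ?_, ?_⟩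
    · rw [Walk.mem_support_append_iff]; exact Or.inl q2
    · rw [Walk.mem_support_append_iff]; right; simp [p2]
    · intro e he
      simp only [Walk.edges_append, Walk.edges_cons, List.mem_append, List.mem_cons] at he
      rcases he with he | rfl | he
      · exact q3 e he
      · exact ⟨w, by simp, hw⟩
      · exact p3 e he
    · rw [Walk.edges_append, Walk.edges_cons, List.map_append, List.map_cons, List.pairwise_append,
        List.pairwise_cons]
      have hlt : ∀ c ∈ p.edges.map nc, d w < c := fun c hc' => by
        have := p5 c hc'; omega
      refine ⟨q4, ⟨fun c hc' => by rw [hc]; exact hlt c hc', p4⟩, ?_⟩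
      intro c hc1 c' hc2
      have h5 := q5 c hc1
      rcases List.mem_cons.1 hc2 with h6 | h6
      · omega
      · have := hlt c' h6; omega
  refine ⟨nc, ?_, ?_⟩
  · intro e
    induction e with
    | _ v w =>
      have : nc s(v, w) = F v w := rfl
      rw [this]; simp only [F]; omega
  intro x hx
  obtain ⟨hxy, hdy⟩ := hπ x (by omega)
  obtain ⟨p, hp1, hp2⟩ := rb_detour (hcyc s(x, π x) hxy)
  obtain ⟨w, z, h1, ⟨h2, h2'⟩, h3, h4⟩ := rb_exit d hadj (fun v => d v ≠ 0 ∧ root v = x) p (by omega)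
    ⟨by omega, hroot1 x hx⟩ (by rintro ⟨h, -⟩; omega)
  have hwz : G.Adj w z := p.adj_of_mem_edges h1
  by_cases hz : d z = 0
  · have hw1 : d w = 1 := by have := hadj _ _ hwz; omega
    have hwx : w = x := by rw [← h2', hroot1 w hw1]
    subst hwx
    have hne : z ≠ π w := by rintro rfl; exact hp1 h1
    have c1 := nc_side w z h2 hz hne
    have c2 := nc_up w h2
    by_cases hlw : l (root w)
    · refine ⟨π w, z, Walk.cons hxy.symm (Walk.cons hwz Walk.nil), by omega, hz, by simp, ?_, ?_⟩
      · simp; exact ⟨Or.inr h2, Or.inl h2⟩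
      · simp only [hlw, if_true] at c1 c2
        simp [Sym2.eq_swap (a := π w)]; omega
    · refine ⟨z, π w, Walk.cons hwz.symm (Walk.cons hxy Walk.nil), hz, by omega, by simp, ?_, ?_⟩
      · simp; exact ⟨Or.inr h2, Or.inl h2⟩
      · simp only [hlw, if_false] at c1 c2
        simp [Sym2.eq_swap (a := z)]; omega
  · have hzx : root z ≠ x := fun h => h3 ⟨hz, h⟩
    obtain ⟨y, ⟨v, v', r1, r2, r3, r4, r5, r6⟩, hly⟩ := hl x ⟨root z, ⟨w, z, hwz, h2, hz, h2', rfl, by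
      have := hk w; have := hk z; omega⟩, hzx.symm⟩
    by_cases hlx : l x
    · obtain ⟨a, b, q, q1, q2, q3, q4, q5⟩ := cross v v' r1 r2 r3 (by rw [r4]; exact hlx)
        (by rw [r5]; exact hly.1 hlx) r6
      exact ⟨a, b, q, q1, q2, r4 ▸ q3, q5⟩
    · obtain ⟨a, b, q, q1, q2, q3, q4, q5⟩ := cross v' v r1.symm r3 r2 (by rw [r5]; tauto)
        (by rw [r4]; exact hlx) (by omega)
      exact ⟨a, b, q, q1, q2, r4 ▸ q4, q5⟩

/-- The set `D` is rainbow connected inside itself by the coloring `c`. -/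
def RbConn (G : SimpleGraph V) (D : Set V) (c : Sym2 V → ℕ) : Prop :=
  ∀ x ∈ D, ∀ y ∈ D, ∃ p : G.Walk x y, (∀ v ∈ p.support, v ∈ D) ∧ (p.edges.map c).Nodup

theorem rb_combine {G : SimpleGraph V} (D D' : Set V) (c nc c' : Sym2 V → ℕ) (N : ℕ)
    (hR : RbConn G D c) (hlt : ∀ x ∈ D, ∀ y ∈ D, G.Adj x y → c s(x, y) < N) (hDD : D ⊆ D')
    (hin : ∀ e, (∀ z ∈ e, z ∈ D) → c' e = c e) (hout : ∀ e, (∃ z ∈ e, z ∉ D) → c' e = N + nc e)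
    (hsplit : ∀ x ∈ D', ∃ t : ℕ,
      (∃ a ∈ D, ∃ p : G.Walk x a, (∀ v ∈ p.support, v ∈ D') ∧ (∀ e ∈ p.edges, ∃ z ∈ e, z ∉ D) ∧
        (p.edges.map nc).Nodup ∧ ∀ e ∈ p.edges, nc e < t) ∧
      (∃ a ∈ D, ∃ p : G.Walk x a, (∀ v ∈ p.support, v ∈ D') ∧ (∀ e ∈ p.edges, ∃ z ∈ e, z ∉ D) ∧
        (p.edges.map nc).Nodup ∧ ∀ e ∈ p.edges, t ≤ nc e)) :
    RbConn G D' c' := by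
  choose! t ht using hsplit
  have key : ∀ x ∈ D', ∀ y ∈ D', t x ≤ t y →
      ∃ p : G.Walk x y, (∀ v ∈ p.support, v ∈ D') ∧ (p.edges.map c').Nodup := by
    intro x hx y hy hxy
    obtain ⟨a, ha, p, p1, p2, p3, p4⟩ := (ht x hx).1
    obtain ⟨b, hb, q, q1, q2, q3, q4⟩ := (ht y hy).2
    obtain ⟨w, w1, w2⟩ := hR a ha b hb
    have win : ∀ e ∈ w.edges, (∀ z ∈ e, z ∈ D) ∧ c' e < N := by
      intro e he
      induction e with
      | _ v z =>
        have hv := w1 v (w.fst_mem_support_of_mem_edges he)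
        have hz := w1 z (w.snd_mem_support_of_mem_edges he)
        have h1 : ∀ y ∈ s(v, z), y ∈ D := by
          intro y hy
          rcases Sym2.mem_iff.1 hy with rfl | rfl <;> assumption
        refine ⟨h1, ?_⟩
        rw [hin _ h1]
        exact hlt v hv z hz (w.adj_of_mem_edges he)
    have pc : p.edges.map c' = (p.edges.map nc).map (N + ·) := by
      rw [List.map_map]
      exact List.map_congr_left fun e he => hout e (p2 e he)
    have qc : q.edges.map c' = (q.edges.map nc).map (N + ·) := by
      rw [List.map_map]
      exact List.map_congr_left fun e he => hout e (q2 e he)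
    have wc : w.edges.map c' = w.edges.map c :=
      List.map_congr_left fun e he => hin e (win e he).1
    have hinj : Function.Injective (N + · : ℕ → ℕ) := fun i j h => by simpa using h
    refine ⟨p.append (w.append q.reverse), ?_, ?_⟩
    · intro v hv
      rw [Walk.mem_support_append_iff, Walk.mem_support_append_iff, Walk.support_reverse,
        List.mem_reverse] at hv
      rcases hv with hv | hv | hv
      · exact p1 v hv
      · exact hDD (w1 v hv)
      · exact q1 v hv
    · rw [Walk.edges_append, Walk.edges_append, Walk.edges_reverse, List.map_append, List.map_append,
        List.map_reverse, List.nodup_append, List.nodup_append, List.nodup_reverse]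
      refine ⟨pc ▸ p3.map hinj, ⟨wc ▸ w2, qc ▸ q3.map hinj, ?_⟩, ?_⟩
      · intro i hi j hj
        rw [List.mem_reverse, List.mem_map] at hj
        rw [List.mem_map] at hi
        obtain ⟨e, he, rfl⟩ := hi
        obtain ⟨f, hf, rfl⟩ := hj
        have := (win e he).2
        have := hout f (q2 f hf)
        omega
      · intro i hi j hj
        rw [List.mem_append, List.mem_reverse, List.mem_map, List.mem_map] at hj
        rw [List.mem_map] at hi
        obtain ⟨e, he, rfl⟩ := hi
        have h1 := hout e (p2 e he)
        have h2 := p4 e he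
        rcases hj with ⟨f, hf, rfl⟩ | ⟨f, hf, rfl⟩
        · have := (win f hf).2
          omega
        · have := hout f (q2 f hf)
          have := q4 f hf
          omega
  intro x hx y hy
  rcases le_total (t x) (t y) with h | h
  · exact key x hx y hy h
  · obtain ⟨p, p1, p2⟩ := key y hy x hx h
    exact ⟨p.reverse, by simpa using p1, by simpa using p2⟩

theorem rb_step [Fintype V] {G : SimpleGraph V} (hconn : G.Connected) (k η : ℕ) (hη : 3 ≤ η)
    (hcyc : ∀ e ∈ G.edgeSet, InCycleLE G e η) (D : Set V)
    (hk : ∀ v, ∃ a ∈ D, G.dist a v ≤ k + 1) (c : Sym2 V → ℕ) (N : ℕ) (hR : RbConn G D c)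
    (hlt : ∀ x ∈ D, ∀ y ∈ D, G.Adj x y → c s(x, y) < N) :
    ∃ (D' : Set V) (c' : Sym2 V → ℕ), (∀ v, ∃ a ∈ D', G.dist a v ≤ k) ∧ RbConn G D' c' ∧
      (∀ x ∈ D', ∀ y ∈ D', G.Adj x y → c' s(x, y) < N + min (2 * (k + 1) + 1) η) := by
  classical
  obtain ⟨d, π, hd, hadj, hπ, hdk⟩ := rb_level hconn D (k + 1) hk
  obtain ⟨nc, hnc, hear⟩ := rb_ears d π hadj hπ (k + 1) η hdk (by omega) hη hcyc _ rfl
  let D' : Set V := {v | ∃ (a b : V) (q : G.Walk a b), a ∈ D ∧ b ∈ D ∧ v ∈ q.support ∧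
    (∀ e ∈ q.edges, ∃ z ∈ e, z ∉ D) ∧ (q.edges.map nc).Pairwise (· < ·)}
  let c' : Sym2 V → ℕ := fun e => if ∃ z ∈ e, z ∉ D then N + nc e else c e
  have hDD : D ⊆ D' := fun v hv => ⟨v, v, Walk.nil, hv, hv, by simp, by simp, by simp⟩
  refine ⟨D', c', ?_, ?_, ?_⟩
  · have hnear : ∀ n v, d v ≤ n + 1 → ∃ a ∈ D', G.dist a v ≤ n := by
      intro n
      induction n with
      | zero =>
        intro v hv
        refine ⟨v, ?_, by simp⟩
        rcases Nat.eq_zero_or_pos (d v) with h | h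
        · exact hDD ((hd v).1 h)
        · obtain ⟨a, b, q, q1, q2, q3, q4, q5⟩ := hear v (by omega)
          refine ⟨a, b, q, (hd a).1 q1, (hd b).1 q2, q3, fun e he => ?_, q5⟩
          obtain ⟨z, hz, hz0⟩ := q4 e he
          exact ⟨z, hz, fun h => hz0 ((hd z).2 h)⟩
      | succ n ih =>
        intro v hv
        by_cases h : d v = 0
        · exact ⟨v, hDD ((hd v).1 h), by simp⟩
        · obtain ⟨h1, h2⟩ := hπ v h
          obtain ⟨a, ha, hl⟩ := ih (π v) (by omega)
          refine ⟨a, ha, ?_⟩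
          have := hconn.dist_triangle (u := a) (v := π v) (w := v)
          have h1 : G.dist (π v) v = 1 := SimpleGraph.dist_eq_one_iff_adj.2 h1.symm
          omega
    exact fun v => hnear k v (hdk v)
  · refine rb_combine D D' c nc c' N hR hlt hDD ?_ ?_ ?_
    · intro e he
      have : ¬ ∃ z ∈ e, z ∉ D := by push Not; exact he
      simp only [c', this, if_false]
    · intro e he
      simp only [c', he, if_true]
    · rintro x ⟨a, b, q, ha, hb, hx, hq, hs⟩
      have hsup : ∀ v ∈ q.support, v ∈ D' := fun v hv => ⟨a, b, q, ha, hb, hv, hq, hs⟩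
      obtain ⟨p₁, p₂, rfl⟩ := Walk.mem_support_iff_exists_append.1 hx
      rw [Walk.edges_append, List.map_append, List.pairwise_append] at hs
      obtain ⟨s1, s2, s3⟩ := hs
      have hq1 : ∀ e ∈ p₁.edges, ∃ z ∈ e, z ∉ D := fun e he => hq e (by simp [he])
      have hq2 : ∀ e ∈ p₂.edges, ∃ z ∈ e, z ∉ D := fun e he => hq e (by simp [he])
      have hp1 : ∀ v ∈ p₁.support, v ∈ D' := fun v hv =>
        hsup v (by rw [Walk.mem_support_append_iff]; exact Or.inl hv)
      have hp2 : ∀ v ∈ p₂.support, v ∈ D' := fun v hv =>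
        hsup v (by rw [Walk.mem_support_append_iff]; exact Or.inr hv)
      have n1 : (p₁.edges.map nc).Nodup := s1.imp (fun h => ne_of_lt h)
      have n2 : (p₂.edges.map nc).Nodup := s2.imp (fun h => ne_of_lt h)
      refine ⟨((p₁.edges.map (fun e => nc e + 1)).toFinset).sup id,
        ⟨a, ha, p₁.reverse, by simpa using hp1, by simpa using hq1, by simpa using n1, ?_⟩,
        ⟨b, hb, p₂, hp2, hq2, n2, ?_⟩⟩
      · intro e he
        rw [Walk.edges_reverse, List.mem_reverse] at he
        have : id (nc e + 1) ≤ ((p₁.edges.map (fun e => nc e + 1)).toFinset).sup id :=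
          Finset.le_sup (f := id) (by rw [List.mem_toFinset]; exact List.mem_map_of_mem he)
        exact this
      · intro f hf
        refine Finset.sup_le fun i hi => ?_
        rw [List.mem_toFinset, List.mem_map] at hi
        obtain ⟨e, he, rfl⟩ := hi
        exact s3 _ (List.mem_map_of_mem he) _ (List.mem_map_of_mem hf)
  · intro x hx y hy hxy
    simp only [c']
    split_ifs with h
    · have := hnc s(x, y); omega
    · push Not at h
      have := hlt x (h x (by simp)) y (h y (by simp)) hxy
      omega

theorem rb_main [Fintype V] {G : SimpleGraph V} (hconn : G.Connected) (η : ℕ) (hη : 3 ≤ η)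
    (hcyc : ∀ e ∈ G.edgeSet, InCycleLE G e η) (k : ℕ) : ∀ (D : Set V) (c : Sym2 V → ℕ) (N : ℕ),
    (∀ v, ∃ a ∈ D, G.dist a v ≤ k) → RbConn G D c →
    (∀ x ∈ D, ∀ y ∈ D, G.Adj x y → c s(x, y) < N) →
    ∃ c' : Sym2 V → ℕ, RbConn G Set.univ c' ∧
      ∀ x y, G.Adj x y → c' s(x, y) < N + ∑ i ∈ Finset.Icc 1 k, min (2 * i + 1) η := by
  induction k with
  | zero =>
    intro D c N hk hR hlt
    have hD : D = Set.univ := by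
      ext v
      obtain ⟨a, ha, h⟩ := hk v
      have : a = v := hconn.dist_eq_zero_iff.1 (by omega)
      simp [← this, ha]
    subst hD
    exact ⟨c, hR, fun x y h => by simpa using hlt x trivial y trivial h⟩
  | succ k ih =>
    intro D c N hk hR hlt
    obtain ⟨D', c', h1, h2, h3⟩ := rb_step hconn k η hη hcyc D hk c N hR hlt
    obtain ⟨c'', h4, h5⟩ := ih D' c' _ h1 h2 h3
    refine ⟨c'', h4, fun x y h => ?_⟩
    have := h5 x y h
    rw [Finset.sum_Icc_succ_top (by omega)]
    omega

theorem rb_fin {G : SimpleGraph V} (c : Sym2 V → ℕ) (hR : RbConn G Set.univ c) (N : ℕ) (hN : 0 < N)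
    (hc : ∀ x y, G.Adj x y → c s(x, y) < N) : RcLE G N := by
  classical
  refine ⟨fun e => ⟨c e % N, Nat.mod_lt _ hN⟩, fun x y _ => ?_⟩
  obtain ⟨p, -, hp⟩ := hR x trivial y trivial
  refine ⟨p.bypass, p.bypass_isPath, ?_⟩
  have hcN : ∀ e ∈ p.edges, c e < N := by
    intro e he
    induction e with
    | _ v z => exact hc v z (p.adj_of_mem_edges he)
  have hnd : p.bypass.edges.Nodup := p.bypass_isPath.isTrail.edges_nodup
  refine List.Nodup.map_on (fun e he f hf hef => ?_) hnd
  have he' := p.edges_bypass_subset_edges he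
  have hf' := p.edges_bypass_subset_edges hf
  have h : c e = c f := by
    have := Fin.mk.inj_iff.1 hef
    rwa [Nat.mod_eq_of_lt (hcN e he'), Nat.mod_eq_of_lt (hcN f hf')] at this
  exact List.inj_on_of_nodup_map hp he' hf' h

/-- A bridgeless connected graph with radius at most `r` in which every
edge lies on a cycle of length at most `η` admits a rainbow coloring with
`∑_{i=1}^{r} min (2i+1) η` colors; in particular, `rc(G) ≤ r * η`. -/
theorem rainbow_connection_bound [Fintype V] (G : SimpleGraph V)
    (hconn : G.Connected) (hbl : Bridgeless G)
    (r : ℕ) (hr : 1 ≤ r) (u : V) (hu : ∀ v : V, G.dist u v ≤ r)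
    (η : ℕ) (hη : 3 ≤ η) (hcyc : ∀ e ∈ G.edgeSet, InCycleLE G e η) :
    RcLE G (∑ i ∈ Finset.Icc 1 r, min (2 * i + 1) η) ∧ RcLE G (r * η) := by
  obtain ⟨c, h1, h2⟩ := rb_main hconn η hη hcyc r {u} (fun _ => 0) 0
    (fun v => ⟨u, rfl, hu v⟩)
    (by rintro x rfl y rfl; exact ⟨Walk.nil, by simp, by simp⟩)
    (by rintro x rfl y rfl h; exact absurd h (G.irrefl))
  rw [Nat.zero_add] at h2
  have hpos : 0 < ∑ i ∈ Finset.Icc 1 r, min (2 * i + 1) η := by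
    refine Finset.sum_pos (fun i _ => by omega) ⟨1, by simp [hr]⟩
  have hle : ∑ i ∈ Finset.Icc 1 r, min (2 * i + 1) η ≤ r * η := by
    calc _ ≤ ∑ i ∈ Finset.Icc 1 r, η := Finset.sum_le_sum fun i _ => min_le_right _ _
      _ = r * η := by simp
  exact ⟨rb_fin c h1 _ hpos h2,
    rb_fin c h1 _ (hpos.trans_le hle) fun x y h => (h2 x y h).trans_le hle⟩
end

section
/- Let G be a finite connected bridgeless edge-transitive graph with at least one edge, let g be the girth of G, and let r ≥ 1 be an integer such that some vertex u of G satisfies d_G(u,v) ≤ r for every vertex v (i.e., rad(G) ≤ r). Then G admits an orientation of radius at most r(g−1) and an orientation of diameter at most 2r(g−1). -/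
open SimpleGraph Finset

variable {V : Type*}

/-- `G` is edge-transitive: any edge can be mapped onto any other edge by an automorphism. -/
def EdgeTransitive (G : SimpleGraph V) : Prop :=
  ∀ e₁ ∈ G.edgeSet, ∀ e₂ ∈ G.edgeSet, ∃ φ : G ≃g G, Sym2.map ⇑φ e₁ = e₂

/-- Directed walks of length `n` along the relation `R`. -/
inductive DW (R : V → V → Prop) : ℕ → V → V → Prop
  | nil (x : V) : DW R 0 x x
  | cons {n : ℕ} {x y z : V} (h : R x y) (t : DW R n y z) : DW R (n + 1) x z

namespace DW

variable {R R' : V → V → Prop}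

theorem mono (h : ∀ x y, R x y → R' x y) {n x y} (w : DW R n x y) : DW R' n x y := by
  induction w with
  | nil x => exact .nil x
  | cons h1 _ ih => exact .cons (h _ _ h1) ih

theorem append {n m x y z} (w : DW R n x y) (w' : DW R m y z) : DW R (n + m) x z := by
  induction w with
  | nil x => simpa using w'
  | @cons k a b c h1 _ ih =>
    have := DW.cons h1 (ih w')
    rwa [show k + 1 + m = k + m + 1 by omega]

theorem snoc {n x y z} (w : DW R n x y) (h : R y z) : DW R (n + 1) x z :=
  w.append (.cons h (.nil z))

theorem rev {n x y} (w : DW R n x y) : DW (fun p q => R q p) n y x := by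
  induction w with
  | nil x => exact .nil x
  | cons h1 _ ih => exact ih.snoc h1

theorem map {W : Type*} {Q : W → W → Prop} (f : V → W) (h : ∀ x y, R x y → Q (f x) (f y))
    {n x y} (w : DW R n x y) : DW Q n (f x) (f y) := by
  induction w with
  | nil x => exact .nil _
  | cons h1 _ ih => exact .cons (h _ _ h1) ih

theorem ofFun {z : ℕ → V} {n : ℕ} (hz : ∀ i < n, R (z i) (z (i + 1))) (i k : ℕ) (hk : i + k ≤ n) :
    DW R k (z i) (z (i + k)) := by
  induction k with
  | zero => exact .nil _
  | succ k ih => exact (ih (by omega)).snoc (hz _ (by omega))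

theorem ofFun' {z : ℕ → V} {n : ℕ} (hz : ∀ i < n, R (z i) (z (i + 1))) {i j : ℕ} (hij : i ≤ j)
    (hk : j ≤ n) : DW R (j - i) (z i) (z j) := by
  have := ofFun hz i (j - i) (by omega)
  rwa [show i + (j - i) = j by omega] at this

theorem toFun {n x y} (w : DW R n x y) :
    ∃ z : ℕ → V, z 0 = x ∧ z n = y ∧ ∀ i < n, R (z i) (z (i + 1)) := by
  induction w with
  | nil x => exact ⟨fun _ => x, rfl, rfl, by simp⟩
  | @cons k a b c h1 _ ih =>
    obtain ⟨z, h0, hn, hz⟩ := ih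
    refine ⟨fun i => if i = 0 then a else z (i - 1), by simp, by simp [hn], ?_⟩
    intro i hi
    rcases i with _ | i
    · simpa [h0] using h1
    · simpa using hz i (by omega)

/-- A shortest walk is a path. -/
theorem dpath {n x y} (w : DW R n x y) : DPathLE R n x y := by
  classical
  have hex : ∃ m, DW R m x y := ⟨n, w⟩
  obtain ⟨z, h0, hn, hz⟩ := (Nat.find_spec hex).toFun
  have hmin : ∀ m, DW R m x y → Nat.find hex ≤ m := fun m hm => Nat.find_min' hex hm
  generalize Nat.find hex = L at *
  refine ⟨L, hmin n w, z, h0, hn, hz, ?_⟩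
  have key : ∀ i j, i < j → j ≤ L → z i ≠ z j := by
    intro i j hij hj he
    have h1 := ofFun' hz (Nat.zero_le i) (by omega)
    have h2 := ofFun' hz hj le_rfl
    rw [he] at h1
    have := hmin _ (h0 ▸ hn ▸ (h1.append h2))
    omega
  intro i hi j hj he
  rcases lt_trichotomy i j with h | h | h
  · exact (key i j h hj he).elim
  · exact h
  · exact (key j i h hi he.symm).elim

end DW

/-- Adjacency of `G` with the edge `x w` deleted. -/
def Del (G : SimpleGraph V) (x w : V) (p q : V) : Prop := G.Adj p q ∧ s(p, q) ≠ s(x, w)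

/-- `t` lies on a directed shortest ear of `S` whose first edge is an out-edge of `S`. -/
def EarOut (G : SimpleGraph V) (S : Set V) (o : V → V → Prop) (t : V) : Prop :=
  ∃ x w s a b, x ∈ S ∧ w ∉ S ∧ s ∈ S ∧ o x w ∧
    DW (fun p q => o p q ∧ p ∉ S ∧ q ∉ S) a w t ∧ DW (fun p q => o p q ∧ p ∉ S) b t s ∧
    ∀ n, ∀ s' ∈ S, DW (Del G x w) n w s' → a + b ≤ n

theorem EarOut.mono {G : SimpleGraph V} {S : Set V} {o o' : V → V → Prop} {t : V}
    (h : EarOut G S o t) (ho : ∀ p q, o p q → o' p q) : EarOut G S o' t := by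
  obtain ⟨x, w, s, a, b, hx, hw, hs, hxw, h1, h2, h3⟩ := h
  exact ⟨x, w, s, a, b, hx, hw, hs, ho _ _ hxw, h1.mono fun p q h => ⟨ho _ _ h.1, h.2⟩,
    h2.mono fun p q h => ⟨ho _ _ h.1, h.2⟩, h3⟩

/-- The invariant of the inner induction. -/
structure EarInv_s7 (G : SimpleGraph V) (S : Set V) (o₀ o : V → V → Prop) (T : Set V) : Prop where
  sub : ∀ p q, o₀ p q → o p q
  adj : ∀ p q, o p q → G.Adj p q
  asymm : ∀ p q, o p q → ¬ o q p
  inl : ∀ p q, o p q → p ∈ S ∪ T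
  inr : ∀ p q, o p q → q ∈ S ∪ T
  disj : ∀ t ∈ T, t ∉ S
  ear : ∀ t ∈ T, EarOut G S o t ∨ EarOut G S (fun p q => o q p) t

theorem EarInv_s7.flip {G : SimpleGraph V} {S : Set V} {o₀ o : V → V → Prop} {T : Set V}
    (h : EarInv_s7 G S o₀ o T) : EarInv_s7 G S (fun p q => o₀ q p) (fun p q => o q p) T where
  sub p q := h.sub q p
  adj p q hh := (h.adj q p hh).symm
  asymm p q := h.asymm q p
  inl p q := h.inr q p
  inr p q := h.inl q p
  disj := h.disj
  ear t ht := (h.ear t ht).symm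

/-- Arcs of a new ear. -/
def PArc (x : V) (z : ℕ → V) (m : ℕ) (p q : V) : Prop :=
  (p = x ∧ q = z 0) ∨ ∃ i < m, p = z i ∧ q = z (i + 1)

theorem EarInv_s7.addPath {G : SimpleGraph V} {S : Set V} {o₀ o : V → V → Prop} {T : Set V}
    (h : EarInv_s7 G S o₀ o T) {x : V} {z : ℕ → V} {m : ℕ} (hx : x ∈ S) (hm : 0 < m)
    (hnew : ∀ i < m, z i ∉ S ∪ T) (hend : z m ∈ S ∪ T)
    (hinj : ∀ i < m, ∀ j < m, z i = z j → i = j) (hadj : G.Adj x (z 0))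
    (hz : ∀ i < m, Del G x (z 0) (z i) (z (i + 1)))
    (hear : ∀ i < m, EarOut G S (fun p q => o p q ∨ PArc x z m p q) (z i) ∨
      EarOut G S (fun p q => o q p ∨ PArc x z m q p) (z i)) :
    EarInv_s7 G S o₀ (fun p q => o p q ∨ PArc x z m p q) (T ∪ (Set.image z (Set.Iio m))) where
  sub p q hh := .inl (h.sub p q hh)
  adj p q hh := by
    rcases hh with hh | ⟨rfl, rfl⟩ | ⟨i, hi, rfl, rfl⟩
    · exact h.adj p q hh
    · exact hadj
    · exact (hz i hi).1
  asymm := by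
    have hold : ∀ p q, PArc x z m p q → ¬ (p ∈ S ∪ T ∧ q ∈ S ∪ T) := by
      rintro p q (⟨rfl, rfl⟩ | ⟨i, hi, rfl, rfl⟩) ⟨h1, h2⟩
      · exact hnew 0 hm h2
      · exact hnew i hi h1
    have hxz : ∀ i < m, z i ≠ x := fun i hi he => hnew i hi (he ▸ Or.inl hx)
    intro p q hh hh'
    rcases hh with hh | hh
    · rcases hh' with hh' | hh'
      · exact h.asymm _ _ hh hh'
      · exact hold _ _ hh' ⟨h.inr _ _ hh, h.inl _ _ hh⟩
    · rcases hh' with hh' | hh'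
      · exact hold _ _ hh ⟨h.inr _ _ hh', h.inl _ _ hh'⟩
      · rcases hh with ⟨rfl, rfl⟩ | ⟨i, hi, rfl, rfl⟩
        · rcases hh' with ⟨h1, h2⟩ | ⟨j, hj, h1, h2⟩
          · exact hxz 0 hm h1
          · refine (hz j hj).2 ?_
            rw [← h1, ← h2]; exact Sym2.eq_swap
        · rcases hh' with ⟨h1, h2⟩ | ⟨j, hj, h1, h2⟩
          · refine (hz i hi).2 ?_
            rw [h1, h2]; exact Sym2.eq_swap
          · by_cases hi' : i + 1 < m
            · have e1 := hinj _ hi' _ hj h1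
              by_cases hj' : j + 1 < m
              · have e2 := hinj _ hi _ hj' h2
                omega
              · have hjm : j + 1 = m := by omega
                rw [hjm] at h2
                exact hnew i hi (h2 ▸ hend)
            · have : i + 1 = m := by omega
              rw [this] at h1
              exact hnew j hj (h1 ▸ hend)
  inl p q hh := by
    rcases hh with hh | ⟨rfl, rfl⟩ | ⟨i, hi, rfl, rfl⟩
    · rcases h.inl p q hh with h1 | h1
      · exact .inl h1
      · exact .inr (.inl h1)
    · exact .inl hx
    · exact .inr (.inr ⟨i, hi, rfl⟩)
  inr p q hh := by
    rcases hh with hh | ⟨rfl, rfl⟩ | ⟨i, hi, rfl, rfl⟩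
    · rcases h.inr p q hh with h1 | h1
      · exact .inl h1
      · exact .inr (.inl h1)
    · exact .inr (.inr ⟨0, hm, rfl⟩)
    · by_cases hi' : i + 1 < m
      · exact .inr (.inr ⟨i + 1, hi', rfl⟩)
      · have : i + 1 = m := by omega
        rw [this]
        rcases hend with h1 | h1
        · exact .inl h1
        · exact .inr (.inl h1)
  disj t ht := by
    rcases ht with ht | ⟨i, hi, rfl⟩
    · exact h.disj t ht
    · exact fun hs => hnew i hi (.inl hs)
  ear t ht := by
    rcases ht with ht | ⟨i, hi, rfl⟩
    · rcases h.ear t ht with h1 | h1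
      · exact .inl (h1.mono fun p q hh => .inl hh)
      · exact .inr (h1.mono fun p q hh => .inl hh)
    · exact hear i hi

theorem EarInv_s7.core1 {G : SimpleGraph V} {S : Set V} {o₀ o : V → V → Prop} {T : Set V}
    (h : EarInv_s7 G S o₀ o T) {x : V} {z : ℕ → V} {m L : ℕ} (hx : x ∈ S) (hm : 0 < m) (hmL : m ≤ L)
    (hnew : ∀ i < m, z i ∉ S ∪ T) (hend : z m ∈ S ∪ T)
    (hinj : ∀ i < m, ∀ j < m, z i = z j → i = j) (hadj : G.Adj x (z 0))
    (hz : ∀ i < L, Del G x (z 0) (z i) (z (i + 1)))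
    (hS : ∀ i < L, z i ∉ S) (hL : z L ∈ S)
    (hmin : ∀ n, ∀ s' ∈ S, DW (Del G x (z 0)) n (z 0) s' → L ≤ n)
    (hy : m = L ∨ EarOut G S o (z m)) :
    ∃ o', EarInv_s7 G S o₀ o' (T ∪ (Set.image z (Set.Iio m))) := by
  have hzm : ∀ i < m, Del G x (z 0) (z i) (z (i + 1)) := fun i hi => hz i (by omega)
  have hx0 : z 0 ∉ S := hS 0 (by omega)
  by_cases hmL' : m = L
  · subst hmL'
    refine ⟨_, h.addPath hx hm hnew hend hinj hadj hzm ?_⟩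
    intro i hi
    left
    refine ⟨x, z 0, z m, i - 0, m - i, hx, hx0, hL, .inr (.inl ⟨rfl, rfl⟩), ?_, ?_, ?_⟩
    · refine DW.ofFun' (n := i) (fun j hj => ⟨.inr (.inr ⟨j, by omega, rfl, rfl⟩), ?_, ?_⟩)
        (Nat.zero_le i) le_rfl
      · exact hS _ (by omega)
      · exact hS _ (by omega)
    · exact DW.ofFun' (n := m) (fun j hj => ⟨.inr (.inr ⟨j, by omega, rfl, rfl⟩), hS _ hj⟩)
        (by omega) le_rfl
    · intro n s' hs' hw
      have := hmin n s' hs' hw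
      omega
  · have hlt : m < L := by omega
    obtain ⟨x', w, s, a, b, hx', hw, hs, hxw, h1, h2, h3⟩ := hy.resolve_left hmL'
    have d1 : DW (Del G x' w) a w (z m) := h1.mono fun p q hh => ⟨h.adj _ _ hh.1, by
      intro he
      rcases Sym2.eq_iff.1 he with ⟨e1, e2⟩ | ⟨e1, e2⟩
      · exact hh.2.1 (e1 ▸ hx')
      · exact hh.2.2 (e2 ▸ hx')⟩
    have d2 : DW (Del G x' w) b (z m) s := h2.mono fun p q hh => ⟨h.adj _ _ hh.1, by
      intro he
      rcases Sym2.eq_iff.1 he with ⟨e1, e2⟩ | ⟨e1, e2⟩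
      · exact hh.2 (e1 ▸ hx')
      · exact h.asymm _ _ hxw (e1 ▸ e2 ▸ hh.1)⟩
    by_cases huse : ∃ i, m ≤ i ∧ i < L ∧ s(z i, z (i + 1)) = s(x', w)
    · obtain ⟨i, hmi, hiL, he⟩ := huse
      have hiw : z i = w := by
        rcases Sym2.eq_iff.1 he with ⟨e1, e2⟩ | ⟨e1, e2⟩
        · exact (hS i hiL (e1 ▸ hx')).elim
        · exact e1
      have hi1 : z (i + 1) = x' := by
        rcases Sym2.eq_iff.1 he with ⟨e1, e2⟩ | ⟨e1, e2⟩
        · exact (hS i hiL (e1 ▸ hx')).elim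
        · exact e2
      have hiL' : i + 1 = L := by
        by_contra hne
        exact hS (i + 1) (by omega) (hi1 ▸ hx')
      have d3 : DW (Del G x' w) (i - m) (z m) (z i) := by
        refine DW.ofFun' (n := i) (fun j hj => ⟨(hz j (by omega)).1, ?_⟩) hmi le_rfl
        intro he'
        rcases Sym2.eq_iff.1 he' with ⟨e1, e2⟩ | ⟨e1, e2⟩
        · exact hS j (by omega) (e1 ▸ hx')
        · exact hS (j + 1) (by omega) (e2 ▸ hx')
      have d4 : DW (Del G x' w) (i - m) w (z m) := by
        have := d3.rev
        rw [hiw] at this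
        exact this.mono fun p q hh => ⟨hh.1.symm, by rw [Sym2.eq_swap]; exact hh.2⟩
      have hab := h3 _ s hs (d4.append d2)
      have := (h.flip).addPath hx hm hnew hend hinj hadj hzm ?_
      · exact ⟨_, this.flip⟩
      intro j hj
      left
      refine ⟨x, z 0, x', j - 0, (m - j) + (a + 1), hx, hx0, hx', .inr (.inl ⟨rfl, rfl⟩),
        ?_, ?_, ?_⟩
      · refine DW.ofFun' (n := j) (fun k hk => ⟨.inr (.inr ⟨k, by omega, rfl, rfl⟩), ?_, ?_⟩)
          (Nat.zero_le j) le_rfl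
        · exact hS _ (by omega)
        · exact hS _ (by omega)
      · refine DW.append (y := z m) ?_ (DW.snoc (y := w) ?_ ⟨.inl hxw, hw⟩)
        · exact DW.ofFun' (n := m)
            (fun k hk => ⟨.inr (.inr ⟨k, by omega, rfl, rfl⟩), hS _ (by omega)⟩)
            (by omega) le_rfl
        · exact h1.rev.mono fun p q hh => ⟨.inl hh.1, hh.2.2⟩
      · intro n s' hs' hw'
        have := hmin n s' hs' hw'
        omega
    · push Not at huse
      have d3 : DW (Del G x' w) (L - m) (z m) (z L) :=
        by
          have := DW.ofFun' (R := Del G x' w) (z := fun i => z (m + i)) (n := L - m)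
            (fun j hj => ⟨(hz (m + j) (by omega)).1, huse (m + j) (by omega) (by omega)⟩)
            (Nat.zero_le (L - m)) le_rfl
          simpa [show m + (L - m) = L by omega] using this
      have hab := h3 _ _ hL (d1.append d3)
      refine ⟨_, h.addPath hx hm hnew hend hinj hadj hzm ?_⟩
      intro j hj
      left
      refine ⟨x, z 0, s, j - 0, (m - j) + b, hx, hx0, hs, .inr (.inl ⟨rfl, rfl⟩),
        ?_, ?_, ?_⟩
      · refine DW.ofFun' (n := j) (fun k hk => ⟨.inr (.inr ⟨k, by omega, rfl, rfl⟩), ?_, ?_⟩)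
          (Nat.zero_le j) le_rfl
        · exact hS _ (by omega)
        · exact hS _ (by omega)
      · refine DW.append (y := z m) ?_ ?_
        · exact DW.ofFun' (n := m)
            (fun k hk => ⟨.inr (.inr ⟨k, by omega, rfl, rfl⟩), hS _ (by omega)⟩)
            (by omega) le_rfl
        · exact h2.mono fun p q hh => ⟨.inl hh.1, hh.2⟩
      · intro n s' hs' hw'
        have := hmin n s' hs' hw'
        omega

theorem EarInv_s7.extend {G : SimpleGraph V} {S : Set V} {o₀ o : V → V → Prop} {T : Set V}
    (h : EarInv_s7 G S o₀ o T) {x v : V} (hx : x ∈ S) (hv : v ∉ S ∪ T) (hadj : G.Adj x v)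
    (hcyc : ∃ n, DW (Del G x v) n v x) :
    ∃ o' T', EarInv_s7 G S o₀ o' T' ∧ T ⊆ T' ∧ v ∈ T' := by
  classical
  have hex : ∃ n, ∃ s ∈ S, DW (Del G x v) n v s := by
    obtain ⟨n, hn⟩ := hcyc
    exact ⟨n, x, hx, hn⟩
  obtain ⟨s, hs, hw⟩ := Nat.find_spec hex
  have hmin : ∀ n, ∀ s' ∈ S, DW (Del G x v) n v s' → Nat.find hex ≤ n :=
    fun n s' hs' hw' => Nat.find_min' hex ⟨s', hs', hw'⟩
  generalize Nat.find hex = L at *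
  obtain ⟨z, rfl, rfl, hz⟩ := hw.toFun
  have hS : ∀ i < L, z i ∉ S := by
    intro i hi hiS
    have := hmin _ _ hiS (DW.ofFun' hz (Nat.zero_le i) (by omega))
    omega
  have key : ∀ i j, i < j → j ≤ L → z i ≠ z j := by
    intro i j hij hj he
    have h1 := DW.ofFun' hz (Nat.zero_le i) (by omega)
    have h2 := DW.ofFun' hz hj le_rfl
    rw [he] at h1
    have := hmin _ _ hs (h1.append h2)
    omega
  have hex2 : ∃ m, z m ∈ S ∪ T := ⟨L, .inl hs⟩
  have hmL : Nat.find hex2 ≤ L := Nat.find_min' hex2 (.inl hs)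
  have hend := Nat.find_spec hex2
  have hnew : ∀ i < Nat.find hex2, z i ∉ S ∪ T := fun i hi => Nat.find_min hex2 hi
  generalize Nat.find hex2 = m at *
  have hm : 0 < m := by
    rcases Nat.eq_zero_or_pos m with h0 | h0
    · exact (hv (h0 ▸ hend)).elim
    · exact h0
  have hinj : ∀ i < m, ∀ j < m, z i = z j → i = j := by
    intro i hi j hj he
    rcases lt_trichotomy i j with h | h | h
    · exact (key i j h (by omega) he).elim
    · exact h
    · exact (key j i h (by omega) he.symm).elim
  have hmem : z 0 ∈ T ∪ (Set.image z (Set.Iio m)) := .inr ⟨0, hm, rfl⟩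
  by_cases hmL' : m = L
  · obtain ⟨o', ho'⟩ := h.core1 hx hm hmL hnew hend hinj hadj hz hS hs hmin (.inl hmL')
    exact ⟨o', _, ho', Set.subset_union_left, hmem⟩
  · have hT : z m ∈ T := hend.resolve_left (hS m (by omega))
    rcases h.ear _ hT with hE | hE
    · obtain ⟨o', ho'⟩ := h.core1 hx hm hmL hnew hend hinj hadj hz hS hs hmin (.inr hE)
      exact ⟨o', _, ho', Set.subset_union_left, hmem⟩
    · obtain ⟨o', ho'⟩ := h.flip.core1 hx hm hmL hnew hend hinj hadj hz hS hs hmin (.inr hE)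
      exact ⟨_, _, ho'.flip, Set.subset_union_left, hmem⟩

/-- A vertex on an ear is close to `S` in both directions. -/
theorem EarOut.bound {G : SimpleGraph V} {S : Set V} {o : V → V → Prop} {t : V} {K : ℕ}
    (h : EarOut G S o t) (ht : t ∉ S) (hadj : ∀ p q, o p q → G.Adj p q)
    (hK : ∀ x v, G.Adj x v → ∃ n ≤ K, DW (Del G x v) n v x) :
    (∃ s ∈ S, ∃ n ≤ K, DW o n s t) ∧ (∃ s ∈ S, ∃ n ≤ K, DW o n t s) := by
  obtain ⟨x, w, s, a, b, hx, hw, hs, hxw, h1, h2, h3⟩ := h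
  obtain ⟨n, hn, hd⟩ := hK x w (hadj _ _ hxw)
  have hab := h3 n x hx hd
  have hb : b ≠ 0 := by
    rintro rfl
    cases h2
    exact ht hs
  exact ⟨⟨x, hx, a + 1, by omega, .cons hxw (h1.mono fun p q hh => hh.1)⟩,
    ⟨s, hs, b, by omega, h2.mono fun p q hh => hh.1⟩⟩

/-- The invariant of the outer induction. -/
structure Outer (G : SimpleGraph V) (u : V) (B : ℕ) (S : Set V) (o : V → V → Prop) : Prop where
  adj : ∀ p q, o p q → G.Adj p q
  asymm : ∀ p q, o p q → ¬ o q p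
  inl : ∀ p q, o p q → p ∈ S
  inr : ∀ p q, o p q → q ∈ S
  fwd : ∀ s ∈ S, ∃ n ≤ B, DW o n u s
  bwd : ∀ s ∈ S, ∃ n ≤ B, DW o n s u

theorem Outer.step [Finite V] {G : SimpleGraph V} {u : V} {B K : ℕ} {S : Set V}
    {o : V → V → Prop} (h : Outer G u B S o)
    (hK : ∀ x v, G.Adj x v → ∃ n ≤ K, DW (Del G x v) n v x) :
    ∃ S' o', Outer G u (B + K) S' o' ∧ S ⊆ S' ∧ ∀ x ∈ S, ∀ v, G.Adj x v → v ∈ S' := by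
  have h0 : EarInv_s7 G S o o ∅ :=
    { sub := fun _ _ h => h
      adj := h.adj
      asymm := h.asymm
      inl := fun p q hh => .inl (h.inl p q hh)
      inr := fun p q hh => .inl (h.inr p q hh)
      disj := by simp
      ear := by simp }
  obtain ⟨T, hT⟩ := (Set.toFinite {T : Set V | ∃ o', EarInv_s7 G S o o' T}).exists_maximal ⟨∅, o, h0⟩
  obtain ⟨o', ho'⟩ := hT.prop
  have hb : ∀ t ∈ T, (∃ s ∈ S, ∃ n ≤ K, DW o' n s t) ∧ (∃ s ∈ S, ∃ n ≤ K, DW o' n t s) := by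
    intro t ht
    rcases ho'.ear t ht with hE | hE
    · exact hE.bound (ho'.disj t ht) ho'.adj hK
    · obtain ⟨⟨s, hs, n, hn, hd⟩, ⟨s', hs', n', hn', hd'⟩⟩ :=
        hE.bound (ho'.disj t ht) ho'.flip.adj hK
      exact ⟨⟨s', hs', n', hn', hd'.rev⟩, ⟨s, hs, n, hn, hd.rev⟩⟩
  refine ⟨S ∪ T, o', ⟨ho'.adj, ho'.asymm, ho'.inl, ho'.inr, ?_, ?_⟩, Set.subset_union_left, ?_⟩
  · rintro t (ht | ht)
    · obtain ⟨n, hn, hd⟩ := h.fwd t ht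
      exact ⟨n, by omega, hd.mono ho'.sub⟩
    · obtain ⟨s, hs, n, hn, hd⟩ := (hb t ht).1
      obtain ⟨n', hn', hd'⟩ := h.fwd s hs
      exact ⟨n' + n, by omega, (hd'.mono ho'.sub).append hd⟩
  · rintro t (ht | ht)
    · obtain ⟨n, hn, hd⟩ := h.bwd t ht
      exact ⟨n, by omega, hd.mono ho'.sub⟩
    · obtain ⟨s, hs, n, hn, hd⟩ := (hb t ht).2
      obtain ⟨n', hn', hd'⟩ := h.bwd s hs
      exact ⟨n + n', by omega, hd.append (hd'.mono ho'.sub)⟩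
  · intro x hx v hxv
    by_contra hv
    obtain ⟨n, _, hn⟩ := hK x v hxv
    obtain ⟨o'', T', h1, h2, h3⟩ := ho'.extend hx hv hxv ⟨n, hn⟩
    exact hv (.inr (hT.le_of_ge ⟨o'', h1⟩ h2 h3))

theorem outer_exists [Finite V] {G : SimpleGraph V} (hconn : G.Connected) (u : V) {K : ℕ}
    (hK : ∀ x v, G.Adj x v → ∃ n ≤ K, DW (Del G x v) n v x) (k : ℕ) :
    ∃ S o, Outer G u (k * K) S o ∧ ∀ v, G.dist u v ≤ k → v ∈ S := by
  induction k with
  | zero =>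
    refine ⟨{u}, fun _ _ => False, ⟨by simp, by simp, by simp, by simp, ?_, ?_⟩, ?_⟩
    · rintro s rfl
      exact ⟨0, by simp, .nil _⟩
    · rintro s rfl
      exact ⟨0, by simp, .nil _⟩
    · intro v hv
      have := (hconn.dist_eq_zero_iff (u := u) (v := v)).1 (by omega)
      exact this.symm
  | succ k ih =>
    obtain ⟨S, o, h, hS⟩ := ih
    obtain ⟨S', o', h', hSS, hN⟩ := h.step hK
    refine ⟨S', o', by rwa [Nat.succ_mul], ?_⟩
    intro v hv
    by_cases hv' : G.dist u v ≤ k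
    · exact hSS (hS v hv')
    · obtain ⟨p, hp⟩ := hconn.exists_walk_length_eq_dist v u
      rw [SimpleGraph.dist_comm] at hp
      cases p with
      | nil => exact (hv' (by simp)).elim
      | @cons _ w _ hadj q =>
        rw [SimpleGraph.Walk.length_cons] at hp
        have h2 : G.dist u w ≤ q.length := by
          rw [SimpleGraph.dist_comm]; exact SimpleGraph.dist_le q
        exact hN w (hS w (by omega)) v hadj.symm

theorem walk_dw {G : SimpleGraph V} {x w : V} {a b : V} (p : G.Walk a b)
    (h : s(x, w) ∉ p.edges) : DW (Del G x w) p.length a b := by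
  induction p with
  | nil => exact .nil _
  | cons hadj q ih =>
    rw [SimpleGraph.Walk.edges_cons, List.mem_cons, not_or] at h
    exact .cons ⟨hadj, fun he => h.1 he.symm⟩ (ih h.2)

theorem short_cycles (G : SimpleGraph V) (hbl : Bridgeless G)
    (hedge : G.edgeSet.Nonempty) (hET : EdgeTransitive G) (x v : V) (hxv : G.Adj x v) :
    ∃ n ≤ G.girth - 1, DW (Del G x v) n v x := by
  have hac : ¬ G.IsAcyclic := by
    intro hac
    obtain ⟨e, he⟩ := hedge
    exact hbl e he (SimpleGraph.isAcyclic_iff_forall_edge_isBridge.1 hac he)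
  obtain ⟨a, c, hc, hl⟩ := SimpleGraph.exists_girth_eq_length.2 hac
  cases c with
  | nil => simp at hc
  | @cons _ b _ hab q =>
    have hq := (SimpleGraph.Walk.cons_isCycle_iff _ _).1 hc
    have d := walk_dw q hq.2
    rw [SimpleGraph.Walk.length_cons] at hl
    refine ⟨q.length, by omega, ?_⟩
    obtain ⟨φ, hφ⟩ := hET s(a, b) hab s(x, v) hxv
    rw [Sym2.map_mk] at hφ
    have hmap : DW (Del G x v) q.length (φ b) (φ a) := by
      refine d.map φ ?_
      intro p q hh
      refine ⟨φ.map_adj_iff.2 hh.1, ?_⟩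
      rw [← hφ]
      intro he
      refine hh.2 (Sym2.map.injective φ.injective ?_)
      simpa using he
    rcases Sym2.eq_iff.1 hφ with ⟨e1, e2⟩ | ⟨e1, e2⟩
    · rwa [e1, e2] at hmap
    · rw [e1, e2] at hmap
      exact hmap.rev.mono fun p q hh => ⟨hh.1.symm, by rw [Sym2.eq_swap]; exact hh.2⟩

theorem DPathLE.le {o : V → V → Prop} {n m : ℕ} {x y : V} (h : DPathLE o n x y) (hnm : n ≤ m) :
    DPathLE o m x y := by
  obtain ⟨k, hk, h⟩ := h
  exact ⟨k, hk.trans hnm, h⟩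

/-- A connected bridgeless edge-transitive graph with an edge, girth `g`
and radius at most `r` admits an orientation of radius at most `r(g-1)` and an orientation
of diameter at most `2r(g-1)`. -/
theorem oriented_bounds_edge_transitive [Fintype V] (G : SimpleGraph V)
    (hconn : G.Connected) (hbl : Bridgeless G)
    (hedge : G.edgeSet.Nonempty) (hET : EdgeTransitive G)
    (g : ℕ) (hg : G.girth = g)
    (r : ℕ) (hr : 1 ≤ r) (u : V) (hu : ∀ v : V, G.dist u v ≤ r) :
    OrientRadiusLE G (r * (g - 1)) ∧ OrientDiamLE G (2 * (r * (g - 1))) := by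
  classical
  have hK := short_cycles G hbl hedge hET
  rw [hg] at hK
  obtain ⟨S, o, h, hS⟩ := outer_exists hconn u hK r
  have hS' : ∀ v, v ∈ S := fun v => hS v (hu v)
  let e := Fintype.equivFin V
  let o' : V → V → Prop := fun x y => o x y ∨ (G.Adj x y ∧ ¬ o x y ∧ ¬ o y x ∧ e x < e y)
  have hsub : ∀ x y, o x y → o' x y := fun x y hh => .inl hh
  have hor : IsOrientation G o' := by
    refine ⟨?_, ?_, ?_⟩
    · rintro x y (hh | hh)
      · exact h.adj _ _ hh
      · exact hh.1
    · intro x y hxy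
      by_cases h1 : o x y
      · exact .inl (.inl h1)
      by_cases h2 : o y x
      · exact .inr (.inl h2)
      have hne : e x ≠ e y := fun he => hxy.ne (e.injective he)
      rcases lt_or_gt_of_ne hne with hlt | hlt
      · exact .inl (.inr ⟨hxy, h1, h2, hlt⟩)
      · exact .inr (.inr ⟨hxy.symm, h2, h1, hlt⟩)
    · rintro x y (hh | hh) (hh' | hh')
      · exact h.asymm _ _ hh hh'
      · exact hh'.2.2.1 hh
      · exact hh.2.2.1 hh'
      · exact lt_asymm hh.2.2.2 hh'.2.2.2
  refine ⟨⟨o', hor, u, fun v => ?_⟩, ⟨o', hor, fun x y => ?_⟩⟩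
  · obtain ⟨n, hn, hd⟩ := h.fwd v (hS' v)
    obtain ⟨n', hn', hd'⟩ := h.bwd v (hS' v)
    exact ⟨(hd.mono hsub).dpath.le hn, (hd'.mono hsub).dpath.le hn'⟩
  · obtain ⟨n, hn, hd⟩ := h.fwd y (hS' y)
    obtain ⟨n', hn', hd'⟩ := h.bwd x (hS' x)
    exact ((hd'.append hd).mono hsub).dpath.le (by omega)
end
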